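/- arXiv:2505.23168 — 2 statements merged into one kernel-verified Lean document; each statement's English description precedes it below -/
import Mathlib

section
/- For every unital Kirchberg algebra A, there exists an aperiodic automorphism γ ∈ Aut(A) (i.e., γ^n is not inner for every n ∈ ℤ∖{0}) whose fixed point algebra is trivial: A^γ = ℂ1_A. -/
/-!  Common definitions: group actions on C*-algebras, ergodicity, outerness,
states, conditional expectations, nuclearity, Kirchberg algebras, amenability. -/

noncomputable section

open scoped ComplexOrder MultiplierAlgebra

/-- An action of a group `G` on a (star) algebra `A` by ⋆-algebra automorphisms. -/
structure CStarAction (G A : Type) [Group G] [Add A] [Mul A] [SMul ℂ A] [Star A] where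
  app : G → A ≃⋆ₐ[ℂ] A
  app_one : ∀ a : A, app 1 a = a
  app_mul : ∀ (g h : G) (a : A), app (g * h) a = app g (app h a)

/-- The trivial action of `G` on `A`. -/
def trivialCStarAction (G A : Type) [Group G] [Add A] [Mul A] [SMul ℂ A] [Star A] :
    CStarAction G A where
  app _ := StarAlgEquiv.refl ℂ A
  app_one _ := rfl
  app_mul _ _ _ := rfl

/-- An automorphism of a unital C*-algebra is inner if it is `Ad u` for a unitary `u`. -/
def IsInnerAut {A : Type} [CStarAlgebra A] (φ : A ≃⋆ₐ[ℂ] A) : Prop :=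
  ∃ u : A, u ∈ unitary A ∧ ∀ a : A, φ a = u * a * star u

/-- The fixed point set of an action. -/
def CStarAction.fixedPoints {G A : Type} [Group G] [Add A] [Mul A] [SMul ℂ A] [Star A]
    (α : CStarAction G A) : Set A :=
  {a : A | ∀ g : G, α.app g a = a}

/-- An action on a unital C*-algebra is ergodic if its fixed point algebra is `ℂ1`. -/
def CStarAction.IsErgodic {G A : Type} [Group G] [CStarAlgebra A]
    (α : CStarAction G A) : Prop :=
  α.fixedPoints = Set.range (fun z : ℂ => z • (1 : A))

/-- An action is point-wise outer if `α g` is not inner for every `g ≠ 1`. -/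
def CStarAction.IsPointwiseOuter {G A : Type} [Group G] [CStarAlgebra A]
    (α : CStarAction G A) : Prop :=
  ∀ g : G, g ≠ 1 → ¬ IsInnerAut (α.app g)

/-- A state on a unital C*-algebra. -/
structure IsState {A : Type} [CStarAlgebra A] (φ : A →ₗ[ℂ] ℂ) : Prop where
  map_one : φ 1 = 1
  pos : ∀ a : A, 0 ≤ φ (star a * a)

/-- A `G`-invariant state. -/
structure IsInvariantState {G A : Type} [Group G] [CStarAlgebra A]
    (α : CStarAction G A) (φ : A →ₗ[ℂ] ℂ) extends IsState φ : Prop where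
  invariant : ∀ (g : G) (a : A), φ (α.app g a) = φ a

/-- A conditional expectation of `A` onto the subalgebra (given as the subset) `S`. -/
structure IsConditionalExpectation {A : Type} [NonUnitalCStarAlgebra A]
    (P : A →ₗ[ℂ] A) (S : Set A) : Prop where
  mem : ∀ a : A, P a ∈ S
  fixes : ∀ a ∈ S, P a = a
  contractive : ∀ a : A, ‖P a‖ ≤ ‖a‖
  positive : ∀ a : A, ∃ b : A, P (star a * a) = star b * b
  left_module : ∀ b ∈ S, ∀ a : A, P (b * a) = b * P a
  right_module : ∀ b ∈ S, ∀ a : A, P (a * b) = P a * b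

/-- Complete positivity of a linear map between star algebras (positivity of all
matrix amplifications, where positivity is witnessed algebraically). -/
def IsCompletelyPositive {A B : Type} [NonUnitalRing A] [StarRing A] [Module ℂ A]
    [NonUnitalRing B] [StarRing B] [Module ℂ B] (φ : A →ₗ[ℂ] B) : Prop :=
  ∀ (n : ℕ) (M : Matrix (Fin n) (Fin n) A), (∃ N : Matrix (Fin n) (Fin n) A, M = N.conjTranspose * N) →
    ∃ N' : Matrix (Fin n) (Fin n) B, M.map φ = N'.conjTranspose * N'

/-- Nuclearity of a C*-algebra, via the completely positive approximation property. -/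
def IsNuclearCStar (A : Type) [NonUnitalCStarAlgebra A] : Prop :=
  ∀ (s : Finset A) (ε : ℝ), 0 < ε →
    ∃ (n : ℕ) (φ : A →ₗ[ℂ] Matrix (Fin n) (Fin n) ℂ) (ψ : Matrix (Fin n) (Fin n) ℂ →ₗ[ℂ] A),
      IsCompletelyPositive φ ∧ IsCompletelyPositive ψ ∧ ∀ a ∈ s, ‖ψ (φ a) - a‖ < ε

/-- Simplicity: no non-trivial closed two-sided ideals (and `A ≠ 0`). -/
def IsSimpleCStarAlgebra (A : Type) [NonUnitalCStarAlgebra A] : Prop :=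
  (∃ a : A, a ≠ 0) ∧
    ∀ I : TwoSidedIdeal A, IsClosed (I : Set A) → (I : Set A) = {0} ∨ (I : Set A) = Set.univ

/-- A unital Kirchberg algebra: separable, nuclear, simple, purely infinite (UCT not assumed). -/
structure IsUnitalKirchberg (A : Type) [CStarAlgebra A] : Prop where
  separable : TopologicalSpace.SeparableSpace A
  nuclear : IsNuclearCStar A
  simple : IsSimpleCStarAlgebra A
  properly_infinite : ∃ s t : A, star s * s = 1 ∧ star t * t = 1 ∧ star s * t = 0
  purely_infinite : ∀ a : A, a ≠ 0 → ∃ x y : A, x * a * y = 1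

/-- A (possibly non-unital) Kirchberg algebra. -/
structure IsKirchberg (A : Type) [NonUnitalCStarAlgebra A] : Prop where
  separable : TopologicalSpace.SeparableSpace A
  nuclear : IsNuclearCStar A
  simple : IsSimpleCStarAlgebra A
  purely_infinite : ∀ a b : A, a ≠ 0 → ∀ ε : ℝ, 0 < ε → ∃ x y : A, ‖x * a * y - b‖ < ε

/-- Amenability of a discrete group: existence of a left invariant finitely additive mean. -/
def IsAmenableGroup (G : Type) [Group G] : Prop :=
  ∃ m : Set G → ℝ, (∀ s, 0 ≤ m s) ∧ m Set.univ = 1 ∧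
    (∀ s t : Set G, Disjoint s t → m (s ∪ t) = m s + m t) ∧
    ∀ (g : G) (s : Set G), m ((g * ·) '' s) = m s

/-- A projection in a C*-algebra. -/
def IsProjectionElem {A : Type} [NonUnitalCStarAlgebra A] (p : A) : Prop :=
  star p = p ∧ p * p = p

/-- An approximate unit consisting of a strictly increasing sequence of projections. -/
def HasIncreasingProjApproxUnit (A : Type) [NonUnitalCStarAlgebra A] : Prop :=
  ∃ p : ℕ → A, (∀ n, IsProjectionElem (p n)) ∧
    (∀ n, p n * p (n + 1) = p n ∧ p (n + 1) * p n = p n ∧ p n ≠ p (n + 1)) ∧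
    ∀ x : A, Filter.Tendsto (fun n => ‖x - p n * x‖ + ‖x - x * p n‖) Filter.atTop (nhds 0)

/-- `A` has a unit. -/
def IsUnitalAlgebra (A : Type) [NonUnitalCStarAlgebra A] : Prop :=
  ∃ e : A, ∀ x : A, e * x = x ∧ x * e = x

end
noncomputable section

open scoped MultiplierAlgebra

/-- A bundled C*-algebra with an action of the group `G` (a "G-C*-algebra"). -/
structure GCStar (G : Type) [Group G] where
  carrier : Type
  [inst : NonUnitalCStarAlgebra carrier]
  act : CStarAction G carrier

attribute [instance] GCStar.inst

/-- A `G`-equivariant ⋆-homomorphism between G-C*-algebras. -/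
structure GHom (G : Type) [Group G] (A B : GCStar G) where
  hom : A.carrier →⋆ₙₐ[ℂ] B.carrier
  equivariant : ∀ (g : G) (a : A.carrier), hom (A.act.app g a) = B.act.app g (hom a)

namespace GHom

variable {G : Type} [Group G]

/-- The identity equivariant homomorphism. -/
def id (A : GCStar G) : GHom G A A where
  hom :=
    { toFun := fun a => a
      map_smul' := fun _ _ => rfl
      map_zero' := rfl
      map_add' := fun _ _ => rfl
      map_mul' := fun _ _ => rfl
      map_star' := fun _ => rfl }
  equivariant _ _ := rfl

/-- Composition (in diagrammatic order: `f.comp g = g ∘ f`). -/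
def comp {A B C : GCStar G} (f : GHom G A B) (g : GHom G B C) : GHom G A C where
  hom := g.hom.comp f.hom
  equivariant h a := by
    simp only [NonUnitalStarAlgHom.comp_apply, f.equivariant, g.equivariant]

end GHom

/-- Forget the `G`-action, yielding an object over the trivial group `PUnit`. -/
def GCStar.forget {G : Type} [Group G] (A : GCStar G) : GCStar PUnit :=
  { carrier := A.carrier, inst := A.inst, act := trivialCStarAction PUnit A.carrier }

/-- Forget equivariance of a morphism. -/
def GHom.forget {G : Type} [Group G] {A B : GCStar G} (f : GHom G A B) :
    GHom PUnit A.forget B.forget :=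
  { hom := f.hom, equivariant := fun _ _ => rfl }

/-- An (abstract) equivariant Kasparov `KK^G`-theory: a category structure on
G-C*-algebras whose morphisms are the `KK^G`-groups, receiving equivariant
⋆-homomorphisms and classes of cocycle morphisms, together with suspension, Bott
periodicity, mapping cones and exact triangles. -/
structure KKTheoryG (G : Type) [Group G] where
  KK : GCStar G → GCStar G → Type
  instAddCommGroup : ∀ A B, AddCommGroup (KK A B)
  unit : (A : GCStar G) → KK A A
  comp : {A B C : GCStar G} → KK A B → KK B C → KK A C
  ofHom : {A B : GCStar G} → GHom G A B → KK A B
  ofCocycle : {A B : GCStar G} → (A.carrier →⋆ₙₐ[ℂ] B.carrier) →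
    (G → 𝓜(ℂ, B.carrier)) → KK A B
  comp_assoc : ∀ {A B C D : GCStar G} (x : KK A B) (y : KK B C) (z : KK C D),
    comp (comp x y) z = comp x (comp y z)
  unit_comp : ∀ {A B : GCStar G} (x : KK A B), comp (unit A) x = x
  comp_unit : ∀ {A B : GCStar G} (x : KK A B), comp x (unit B) = x
  ofHom_id : ∀ A : GCStar G, ofHom (GHom.id A) = unit A
  ofHom_comp : ∀ {A B C : GCStar G} (f : GHom G A B) (g : GHom G B C),
    ofHom (f.comp g) = comp (ofHom f) (ofHom g)
  ofCocycle_one : ∀ {A B : GCStar G} (f : GHom G A B),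
    ofCocycle f.hom (fun _ => 1) = ofHom f
  susp : GCStar G → GCStar G
  suspGHom : {A B : GCStar G} → GHom G A B → GHom G (susp A) (susp B)
  suspKK : {A B : GCStar G} → KK A B → KK (susp A) (susp B)
  bott : (A : GCStar G) → KK A (susp (susp A))
  bott_invertible : ∀ A : GCStar G,
    ∃ y : KK (susp (susp A)) A, comp (bott A) y = unit A ∧ comp y (bott A) = unit (susp (susp A))
  cone : {A B : GCStar G} → GHom G A B → GCStar G
  coneEval : {A B : GCStar G} → (f : GHom G A B) → GHom G (cone f) A
  coneIota : {A B : GCStar G} → (f : GHom G A B) → KK (susp B) (cone f)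
  coneJ : {A B J : GCStar G} → (f : GHom G A B) → (l : GHom G J A) →
    (∀ x, f.hom (l.hom x) = 0) → KK J (cone f)
  exactTriangle : {X A B : GCStar G} → KK (susp X) A → KK A B → KK B X → Prop
  triangle_cone : ∀ {A B : GCStar G} (f : GHom G A B),
    exactTriangle (coneIota f) (ofHom (coneEval f)) (ofHom f)

attribute [instance] KKTheoryG.instAddCommGroup

namespace KKTheoryG

variable {G : Type} [Group G]

/-- A class is a `KK^G`-equivalence if it is invertible for the Kasparov product. -/
def IsEquiv (kk : KKTheoryG G) {A B : GCStar G} (x : kk.KK A B) : Prop :=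
  ∃ y : kk.KK B A, kk.comp x y = kk.unit A ∧ kk.comp y x = kk.unit B

end KKTheoryG

/-- Non-equivariant `KK`-theory, seen as `KK`-theory over the trivial group. -/
abbrev KKTheory := KKTheoryG PUnit

/-- The forgetful functor `F : KK^G → KK`. -/
structure KKForget {G : Type} [Group G] (kkG : KKTheoryG G) (kk : KKTheory) where
  map : ∀ {A B : GCStar G}, kkG.KK A B → kk.KK A.forget B.forget
  map_ofHom : ∀ {A B : GCStar G} (f : GHom G A B), map (kkG.ofHom f) = kk.ofHom f.forget
  map_comp : ∀ {A B C : GCStar G} (x : kkG.KK A B) (y : kkG.KK B C),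
    map (kkG.comp x y) = kk.comp (map x) (map y)
  map_unit : ∀ A : GCStar G, map (kkG.unit A) = kk.unit A.forget

/-- The unital homomorphism `ℂ → A`, `z ↦ z • 1`. -/
def unitHomC (A : Type) [CStarAlgebra A] : ℂ →⋆ₙₐ[ℂ] A where
  toFun z := z • (1 : A)
  map_smul' z w := by simp [smul_smul]
  map_zero' := by simp
  map_add' z w := by simp [add_smul]
  map_mul' z w := by
    simp [smul_smul, smul_mul_smul_comm, mul_comm]
  map_star' z := by simp [star_smul, RCLike.star_def]

/-- Bundle an algebra with an action as a G-C*-algebra. -/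
abbrev GCStar.of (G : Type) [Group G] (A : Type) [NonUnitalCStarAlgebra A]
    (α : CStarAction G A) : GCStar G :=
  { carrier := A, act := α }

/-- `ℂ` as a G-C*-algebra with the trivial action. -/
abbrev GCStar.C (G : Type) [Group G] : GCStar G :=
  GCStar.of G ℂ (trivialCStarAction G ℂ)

lemma StarAlgEquiv.map_one' {A : Type} [CStarAlgebra A] (e : A ≃⋆ₐ[ℂ] A) : e 1 = 1 := by
  have h : e 1 * e 1 = e 1 := by rw [← map_mul]; simp
  have hsurj : Function.Surjective e := e.surjective
  have : ∀ y : A, e 1 * y = y := by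
    intro y
    obtain ⟨x, rfl⟩ := hsurj y
    calc e 1 * e x = e (1 * x) := (map_mul e 1 x).symm
    _ = e x := by rw [one_mul]
  have h1 := this 1
  rwa [mul_one] at h1

/-- The unit `ℂ → A` as an equivariant morphism for any action on a unital `A`. -/
def unitGHom {G : Type} [Group G] (A : Type) [CStarAlgebra A] (α : CStarAction G A) :
    GHom G (GCStar.C G) (GCStar.of G A α) where
  hom := unitHomC A
  equivariant g z := by
    have h : (α.app g) (z • (1 : A)) = z • (1 : A) := by
      rw [map_smul, StarAlgEquiv.map_one' (α.app g)]
    exact h.symm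

/-- A unital ⋆-homomorphism as an equivariant morphism for the trivial actions. -/
def toTrivGHom {A B : Type} [CStarAlgebra A] [CStarAlgebra B] (f : A →⋆ₐ[ℂ] B) :
    GHom PUnit (GCStar.of PUnit A (trivialCStarAction PUnit A))
      (GCStar.of PUnit B (trivialCStarAction PUnit B)) where
  hom := f.toNonUnitalStarAlgHom
  equivariant _ _ := rfl

/-- A ⋆-homomorphism as an equivariant morphism for the trivial actions. -/
def trivGHomOfHom {A B : Type} [NonUnitalCStarAlgebra A] [NonUnitalCStarAlgebra B]
    (f : A →⋆ₙₐ[ℂ] B) :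
    GHom PUnit (GCStar.of PUnit A (trivialCStarAction PUnit A))
      (GCStar.of PUnit B (trivialCStarAction PUnit B)) where
  hom := f
  equivariant _ _ := rfl

/-- Matrix-unit data exhibiting `BK` as the stabilization `B ⊗ K(ℓ²(ι))` of `B`:
`θ i j b` plays the role of `b ⊗ e_{i,j}`. -/
structure MatrixUnitsData (ι B BK : Type) [DecidableEq ι] [NonUnitalCStarAlgebra B]
    [NonUnitalCStarAlgebra BK] where
  θ : ι → ι → (B →ₗ[ℂ] BK)
  mul_rel : ∀ (i j k l : ι) (b c : B),
    θ i j b * θ k l c = if j = k then θ i l (b * c) else 0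
  star_rel : ∀ (i j : ι) (b : B), star (θ i j b) = θ j i (star b)
  norm_rel : ∀ (i j : ι) (b : B), ‖θ i j b‖ = ‖b‖
  dense : closure (Submodule.span ℂ (⋃ i : ι, ⋃ j : ι, Set.range (θ i j)) : Set BK) = Set.univ

/-- The corner embedding `B → B ⊗ K` associated to a fixed minimal projection,
built from matrix-unit data. -/
def MatrixUnitsData.cornerHom {ι B BK : Type} [DecidableEq ι] [NonUnitalCStarAlgebra B]
    [NonUnitalCStarAlgebra BK] (d : MatrixUnitsData ι B BK) (i : ι) : B →⋆ₙₐ[ℂ] BK where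
  toFun b := d.θ i i b
  map_smul' z b := by simp
  map_zero' := by simp
  map_add' b c := by simp
  map_mul' b c := by rw [d.mul_rel]; simp
  map_star' b := by rw [d.star_rel]

end
noncomputable section

/-! The standing assumptions of the Pimsner construction (Sec. 4.1 of the paper),
encoded as a structure: `B` unital separable nuclear, `E` separable non-unital
nuclear containing `B ⊗ K` as an essential ideal, a non-degenerate representation
`E ⊆ B(H)` and a compatible unitary representation of `G`, together with the
Toeplitz--Pimsner algebra `T_X` of the G-Hilbert bimodule `X = H ⊗ ℓ²(G) ⊗ E`
(presented by its creation operators `Tcr`), its gauge action and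
the quasi-free `G`-action `Γ`. -/
structure PimsnerSetting (G : Type) [Group G] [DecidableEq G] where
  B : Type
  [instB : CStarAlgebra B]
  sepB : TopologicalSpace.SeparableSpace B
  nucB : IsNuclearCStar B
  BK : Type
  [instBK : NonUnitalCStarAlgebra BK]
  stab : MatrixUnitsData ℕ B BK
  E : Type
  [instE : NonUnitalCStarAlgebra E]
  sepE : TopologicalSpace.SeparableSpace E
  nucE : IsNuclearCStar E
  nonunitalE : ¬ IsUnitalAlgebra E
  approxE : HasIncreasingProjApproxUnit E
  jBK : BK →⋆ₙₐ[ℂ] E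
  jBK_inj : Function.Injective jBK
  ideal_left : ∀ (x : E) (y : BK), x * jBK y ∈ Set.range jBK
  ideal_right : ∀ (x : E) (y : BK), jBK y * x ∈ Set.range jBK
  essential : ∀ x : E, (∀ y : BK, x * jBK y = 0) → x = 0
  H : Type
  [instH : NormedAddCommGroup H]
  [instH2 : InnerProductSpace ℂ H]
  [instH3 : CompleteSpace H]
  rep : E →⋆ₙₐ[ℂ] (H →L[ℂ] H)
  rep_inj : Function.Injective rep
  rep_nondeg : ∀ ζ : H, (∀ x : E, rep x ζ = 0) → ζ = 0
  U : G → (H →L[ℂ] H)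
  U_unitary : ∀ g, U g ∈ unitary (H →L[ℂ] H)
  U_mul : ∀ g h, U (g * h) = U g * U h
  αE : CStarAction G E
  αE_rep : ∀ g x, rep (αE.app g x) = U g * rep x * star (U g)
  αE_BK : ∀ g y, αE.app g (jBK y) ∈ Set.range jBK
  U_fix : ∀ g, U g * rep (jBK (stab.θ 0 0 1)) = rep (jBK (stab.θ 0 0 1))
  fix_U : ∀ g, rep (jBK (stab.θ 0 0 1)) * U g = rep (jBK (stab.θ 0 0 1))
  TX : Type
  [instTX : NonUnitalCStarAlgebra TX]
  ιE : E →⋆ₙₐ[ℂ] TX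
  ιE_inj : Function.Injective ιE
  Tcr : H → G → E → TX
  Tcr_addH : ∀ ζ ξ h x, Tcr (ζ + ξ) h x = Tcr ζ h x + Tcr ξ h x
  Tcr_smulH : ∀ (c : ℂ) ζ h x, Tcr (c • ζ) h x = c • Tcr ζ h x
  Tcr_addE : ∀ ζ h x y, Tcr ζ h (x + y) = Tcr ζ h x + Tcr ζ h y
  Tcr_right : ∀ ζ h x y, Tcr ζ h x * ιE y = Tcr ζ h (x * y)
  Tcr_left : ∀ a ζ h x, ιE a * Tcr ζ h x = Tcr (rep a ζ) h x
  Tcr_star : ∀ ζ h x ξ k y,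
    star (Tcr ζ h x) * Tcr ξ k y = if h = k then (inner ℂ ζ ξ : ℂ) • ιE (star x * y) else 0
  generates : closure ((NonUnitalStarAlgebra.adjoin ℂ
      {t : TX | ∃ ζ h x, t = Tcr ζ h x} : NonUnitalStarSubalgebra ℂ TX) : Set TX) = Set.univ
  vac : TX →ₗ[ℂ] E
  vac_ι : ∀ x, vac (ιE x) = x
  vac_creation : ∀ ζ h x t, vac (Tcr ζ h x * t) = 0
  vac_annihilation : ∀ ζ h x t, vac (t * star (Tcr ζ h x)) = 0
  vac_cr : ∀ ζ h x, vac (Tcr ζ h x) = 0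
  vac_positive : ∀ t, ∃ y, vac (star t * t) = star y * y
  vac_contractive : ∀ t, ‖vac t‖ ≤ ‖t‖
  gauge : CStarAction Circle TX
  gauge_cr : ∀ z ζ h x, gauge.app z (Tcr ζ h x) = (z : ℂ) • Tcr ζ h x
  gauge_ι : ∀ z x, gauge.app z (ιE x) = ιE x
  Γ : CStarAction G TX
  Γ_cr : ∀ g ζ h x, Γ.app g (Tcr ζ h x) = Tcr (U g ζ) (g * h) (αE.app g x)
  Γ_ι : ∀ g x, Γ.app g (ιE x) = ιE (αE.app g x)

attribute [instance] PimsnerSetting.instB PimsnerSetting.instBK PimsnerSetting.instE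
  PimsnerSetting.instH PimsnerSetting.instH2 PimsnerSetting.instH3 PimsnerSetting.instTX

namespace PimsnerSetting

variable {G : Type} [Group G] [DecidableEq G] (S : PimsnerSetting G)

/-- The projection `1_B ⊗ e₀ ∈ B ⊗ K ⊆ E`. -/
def unitProj : S.E := S.jBK (S.stab.θ 0 0 1)

/-- The projection `1_B ⊗ e₀`, viewed in `T_X`. -/
def unitProjT : S.TX := S.ιE S.unitProj

/-- The corner `A_E = (1_B ⊗ e₀) T_X (1_B ⊗ e₀)`. -/
def corner : Set S.TX := {y : S.TX | S.unitProjT * y = y ∧ y * S.unitProjT = y}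

/-- The unital embedding `ι : B → A_E`, `b ↦ b ⊗ e₀`. -/
def cornerEmb : S.B → S.TX := fun b => S.ιE (S.jBK (S.stab.θ 0 0 b))

end PimsnerSetting

/-! The setting of Sec. 3 of the paper: a unital essential extension `K ◁ E`
of `C` by the compacts, non-degenerately represented on `H`, the Toeplitz--Pimsner
algebra `T_X` of `X = H ⊗ ℓ²(ℤ) ⊗ E`, and the shift quasi-free automorphism `Γ`
(given as a `ℤ`-action). -/
structure ToeplitzShiftSetting where
  H : Type
  [instH : NormedAddCommGroup H]
  [instH2 : InnerProductSpace ℂ H]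
  [instH3 : CompleteSpace H]
  E : Type
  [instE : CStarAlgebra E]
  sepE : TopologicalSpace.SeparableSpace E
  rep : E →⋆ₐ[ℂ] (H →L[ℂ] H)
  rep_inj : Function.Injective rep
  compacts_sub : ∀ T : H →L[ℂ] H, IsCompactOperator (⇑T) → T ∈ Set.range rep
  id_not_compact : ¬ IsCompactOperator (⇑(1 : H →L[ℂ] H))
  C : Type
  [instC : CStarAlgebra C]
  sepC : TopologicalSpace.SeparableSpace C
  nucC : IsNuclearCStar C
  quot : E →⋆ₐ[ℂ] C
  quot_surj : Function.Surjective quot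
  quot_ker : ∀ x : E, quot x = 0 ↔ IsCompactOperator (⇑(rep x))
  TX : Type
  [instTX : CStarAlgebra TX]
  ιE : E →⋆ₐ[ℂ] TX
  ιE_inj : Function.Injective ιE
  Tcr : H → ℤ → E → TX
  Tcr_addH : ∀ ζ ξ n x, Tcr (ζ + ξ) n x = Tcr ζ n x + Tcr ξ n x
  Tcr_smulH : ∀ (c : ℂ) ζ n x, Tcr (c • ζ) n x = c • Tcr ζ n x
  Tcr_addE : ∀ ζ n x y, Tcr ζ n (x + y) = Tcr ζ n x + Tcr ζ n y
  Tcr_right : ∀ ζ n x y, Tcr ζ n x * ιE y = Tcr ζ n (x * y)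
  Tcr_left : ∀ a ζ n x, ιE a * Tcr ζ n x = Tcr (rep a ζ) n x
  Tcr_star : ∀ ζ m x ξ n y,
    star (Tcr ζ m x) * Tcr ξ n y = if m = n then (inner ℂ ζ ξ : ℂ) • ιE (star x * y) else 0
  generates : closure ((NonUnitalStarAlgebra.adjoin ℂ
      {t : TX | ∃ ζ n x, t = Tcr ζ n x} : NonUnitalStarSubalgebra ℂ TX) : Set TX) = Set.univ
  vac : TX →ₗ[ℂ] E
  vac_ι : ∀ x, vac (ιE x) = x
  vac_creation : ∀ ζ n x t, vac (Tcr ζ n x * t) = 0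
  vac_annihilation : ∀ ζ n x t, vac (t * star (Tcr ζ n x)) = 0
  vac_cr : ∀ ζ n x, vac (Tcr ζ n x) = 0
  Γ : CStarAction (Multiplicative ℤ) TX
  Γ_cr : ∀ (n : ℤ) ζ m x,
    Γ.app (Multiplicative.ofAdd n) (Tcr ζ m x) = Tcr ζ (n + m) x
  Γ_ι : ∀ (n : ℤ) (x : E), Γ.app (Multiplicative.ofAdd n) (ιE x) = ιE x

attribute [instance] ToeplitzShiftSetting.instH ToeplitzShiftSetting.instH2
  ToeplitzShiftSetting.instH3 ToeplitzShiftSetting.instE ToeplitzShiftSetting.instC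
  ToeplitzShiftSetting.instTX

end
namespace KbProof

section basics
variable {A : Type} [CStarAlgebra A]

/-- Inverse square root of an element whose spectrum is bounded below by a positive number. -/
lemma exists_invSqrt (c : A) (hc : IsSelfAdjoint c) (hs : ∀ t ∈ spectrum ℝ c, 0 < t) :
    ∃ r : A, IsSelfAdjoint r ∧ r * c * r = 1 ∧ (∀ q : A, Commute c q → Commute r q) ∧
      (‖c - 1‖ ≤ 1/2 → ‖r - 1‖ ≤ ‖c - 1‖) := by
  have hcont : ContinuousOn (fun t : ℝ => (Real.sqrt t)⁻¹) (spectrum ℝ c) := by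
    apply ContinuousOn.inv₀ (Real.continuous_sqrt.continuousOn)
    intro t ht
    exact (Real.sqrt_pos.2 (hs t ht)).ne'
  refine ⟨cfc (fun t : ℝ => (Real.sqrt t)⁻¹) c, cfc_predicate _ _, ?_, ?_, ?_⟩
  · have h1 : cfc (fun t : ℝ => (Real.sqrt t)⁻¹) c * c * cfc (fun t : ℝ => (Real.sqrt t)⁻¹) c
        = cfc (fun t : ℝ => (Real.sqrt t)⁻¹ * t * (Real.sqrt t)⁻¹) c := by
      rw [cfc_mul (fun t : ℝ => (Real.sqrt t)⁻¹ * t) (fun t : ℝ => (Real.sqrt t)⁻¹) c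
        (hcont.mul continuousOn_id) hcont]
      rw [cfc_mul (fun t : ℝ => (Real.sqrt t)⁻¹) (fun t : ℝ => t) c hcont continuousOn_id]
      rw [cfc_id' ℝ c]
    rw [h1, ← cfc_one ℝ c]
    apply cfc_congr
    intro t ht
    have := Real.sqrt_pos.2 (hs t ht)
    have h2 := Real.mul_self_sqrt (hs t ht).le
    simp only [Pi.one_apply]
    field_simp
    nlinarith
  · intro q hq
    exact hq.cfc_real _
  · intro hle
    have h1 : cfc (fun t : ℝ => (Real.sqrt t)⁻¹) c - 1
        = cfc (fun t : ℝ => (Real.sqrt t)⁻¹ - 1) c := by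
      rw [cfc_sub (fun t : ℝ => (Real.sqrt t)⁻¹) (fun _ => 1) c hcont continuousOn_const]
      rw [cfc_const_one ℝ c]
    rw [h1]
    apply norm_cfc_le (norm_nonneg _)
    intro t ht
    have htc : |t - 1| ≤ ‖c - 1‖ := by
      have hm : t - 1 ∈ spectrum ℝ (c - 1) := by
        have := spectrum.sub_singleton_eq (R := ℝ) c 1
        rw [map_one] at this
        rw [← this]
        exact Set.sub_mem_sub ht rfl
      have := spectrum.norm_le_norm_mul_of_mem hm
      by_cases hA : Nontrivial A
      · simpa using this
      · rw [not_nontrivial_iff_subsingleton] at hA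
        simp at ht
    have ht0 := hs t ht
    have hsq := Real.sqrt_pos.2 ht0
    have h2 := Real.mul_self_sqrt ht0.le
    have ht2 : 1/2 ≤ t := by
      have := (abs_le.1 (htc.trans hle)).1
      linarith
    refine le_trans ?_ htc
    rw [Real.norm_eq_abs]
    have h3 : (Real.sqrt t)⁻¹ - 1 = (1 - t) * (Real.sqrt t * (1 + Real.sqrt t))⁻¹ := by
      field_simp
      nlinarith
    rw [h3, abs_mul, abs_sub_comm]
    have h4 : 1 ≤ Real.sqrt t * (1 + Real.sqrt t) := by
      have : (1:ℝ)/2 ≤ Real.sqrt t := by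
        rw [Real.le_sqrt' (by norm_num)]; linarith
      nlinarith
    have h5 : |(Real.sqrt t * (1 + Real.sqrt t))⁻¹| ≤ 1 := by
      rw [abs_of_pos (by positivity)]
      exact inv_le_one_of_one_le₀ h4
    nlinarith [abs_nonneg (t-1)]

lemma exists_isometry_of_left_inv (x b : A) (h : x * b = 1) :
    ∃ r : A, star (b * r) * (b * r) = 1 := by
  letI : PartialOrder A := CStarAlgebra.spectralOrder A
  letI : StarOrderedRing A := CStarAlgebra.spectralOrderedRing A
  have hc : 0 ≤ star b * b := star_mul_self_nonneg b
  have hu : IsUnit (star b * b) := by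
    by_cases hA : Nontrivial A
    · have hx : 0 < ‖x‖ := by
        rw [norm_pos_iff]; rintro rfl; simp at h
      have h1 : (1 : A) ≤ ‖star x * x‖ • (star b * b) := by
        have := CStarAlgebra.star_left_conjugate_le_norm_smul (a := b) (b := star x * x)
          (hb := IsSelfAdjoint.star_mul_self x)
        have h2 : star b * (star x * x) * b = 1 := by
          calc star b * (star x * x) * b = star (x * b) * (x * b) := by
                simp [star_mul, mul_assoc]
            _ = 1 := by rw [h]; simp
        rwa [h2] at this
      have h2 : IsUnit (‖star x * x‖ • (star b * b)) :=
        CStarAlgebra.isUnit_of_le (1 : A) h1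
      have hn : ‖star x * x‖ ≠ 0 := by
        rw [CStarRing.norm_star_mul_self]; positivity
      have := (IsUnit.mk0 _ hn)
      have h3 := h2.smul (this.unit⁻¹)
      rw [Units.smul_def, smul_smul] at h3
      simpa [hn] using h3
    · rw [not_nontrivial_iff_subsingleton] at hA
      exact isUnit_of_subsingleton _
  obtain ⟨r, hr, hr2, -, -⟩ := exists_invSqrt (star b * b) (IsSelfAdjoint.star_mul_self b) (by
    intro t ht
    have h0 : 0 ≤ t := spectrum_nonneg_of_nonneg hc ht
    rcases h0.lt_or_eq with h0 | h0
    · exact h0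
    · subst h0
      exact absurd hu (spectrum.zero_mem_iff ℝ |>.1 ht))
  refine ⟨r, ?_⟩
  rw [star_mul, hr.star_eq]
  simpa [mul_assoc] using hr2

lemma isom_norm_le (z : A) (hz : star z * z = 1) : ‖z‖ ≤ 1 := by
  by_cases hA : Nontrivial A
  · have : ‖z‖ * ‖z‖ = 1 := by rw [← CStarRing.norm_star_mul_self, hz, norm_one]
    nlinarith [norm_nonneg z]
  · rw [not_nontrivial_iff_subsingleton] at hA
    rw [Subsingleton.elim z 0]; simp

lemma isom_conj_norm_le (z a : A) (hz : star z * z = 1) : ‖star z * a * z‖ ≤ ‖a‖ := by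
  have h1 := isom_norm_le z hz
  calc ‖star z * a * z‖ ≤ ‖star z‖ * ‖a‖ * ‖z‖ :=
        (norm_mul_le _ _).trans (by gcongr; exact norm_mul_le _ _)
    _ ≤ 1 * ‖a‖ * 1 := by rw [norm_star]; gcongr
    _ = ‖a‖ := by ring

lemma exists_compress_sa (hpi : ∀ a : A, a ≠ 0 → ∃ x y : A, x * a * y = 1) [Nontrivial A]
    (a : A) (ha : IsSelfAdjoint a) (ε : ℝ) (hε : 0 < ε) :
    ∃ z : A, star z * z = 1 ∧ ∃ l : ℂ, ‖star z * a * z - l • (1 : A)‖ ≤ ε := by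
  obtain ⟨l, hl⟩ : (spectrum ℝ a).Nonempty := ContinuousFunctionalCalculus.spectrum_nonempty a ha
  set δ := ε / 2
  have hδ : 0 < δ := half_pos hε
  let g : ℝ → ℝ := fun t => max 0 (1 - |t - l| / δ)
  let k : ℝ → ℝ := fun t => max 0 (min 1 (2 - |t - l| / δ))
  have hg : Continuous g := by fun_prop
  have hk : Continuous k := by fun_prop
  have hkg : cfc k a * cfc g a = cfc g a := by
    rw [← cfc_mul k g a hk.continuousOn hg.continuousOn]
    apply cfc_congr
    intro t _
    simp only [k, g]
    rcases le_total (1 - |t - l| / δ) 0 with h | h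
    · simp [max_eq_left h]
    · have : min 1 (2 - |t - l| / δ) = 1 := min_eq_left (by linarith)
      simp [this]
  have hg0 : cfc g a ≠ 0 := by
    intro h0
    have h1 := cfc_map_spectrum g a ha hg.continuousOn
    have h2 : g l ∈ spectrum ℝ (cfc g a) := by rw [h1]; exact ⟨l, hl, rfl⟩
    rw [h0] at h2
    simp [g] at h2
  obtain ⟨x, y, hxy⟩ := hpi _ hg0
  obtain ⟨r, hr⟩ := exists_isometry_of_left_inv x (cfc g a * y) (by rw [← mul_assoc]; exact hxy)
  set z := cfc g a * y * r with hzdef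
  refine ⟨z, hr, (l : ℂ), ?_⟩
  have hkz : cfc k a * z = z := by
    rw [hzdef, ← mul_assoc, ← mul_assoc, hkg]
  have hz1 := isom_norm_le z hr
  have key : star z * a * z - (l : ℂ) • (1 : A) = star z * (cfc (fun t => (t - l) * k t) a) * z := by
    rw [cfc_mul (fun t => t - l) k a (by fun_prop) hk.continuousOn]
    rw [cfc_sub (fun t => t) (fun _ => l) a (by fun_prop) (by fun_prop), cfc_id' ℝ a, cfc_const l a]
    have : star z * ((a - (algebraMap ℝ A) l) * cfc k a) * z
      = star z * (a - (algebraMap ℝ A) l) * (cfc k a * z) := by simp only [mul_assoc]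
    rw [this, hkz, mul_sub, sub_mul]
    congr 1
    rw [Algebra.algebraMap_eq_smul_one, mul_smul_comm, mul_one, smul_mul_assoc, hr]
    simp
  rw [key]
  refine (isom_conj_norm_le _ _ hr).trans ?_
  apply norm_cfc_le hε.le
  intro t _
  simp only [k, Real.norm_eq_abs, abs_mul]
  rcases le_total (2 - |t - l| / δ) 0 with h | h
  · rw [min_eq_right (by linarith), max_eq_left h]; simp; exact hε.le
  · have h2 : |t - l| ≤ ε := by
      have : |t - l| / δ ≤ 2 := by linarith
      rw [div_le_iff₀ hδ] at this
      have : 2 * δ = ε := by simp only [δ]; ring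
      linarith
    have h3 : |max 0 (min 1 (2 - |t - l| / δ))| ≤ 1 := by
      rw [abs_of_nonneg (le_max_left _ _)]
      exact max_le (by norm_num) (min_le_left _ _)
    nlinarith [abs_nonneg (t - l)]

lemma isom_mul (z w : A) (hz : star z * z = 1) (hw : star w * w = 1) :
    star (z * w) * (z * w) = 1 := by
  rw [star_mul, mul_assoc, ← mul_assoc (star z), hz, one_mul, hw]

lemma compress_mul (z w a : A) (hw : star w * w = 1) (l : ℂ) :
    ‖star (z * w) * a * (z * w) - l • (1 : A)‖ ≤ ‖star z * a * z - l • (1 : A)‖ := by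
  have : star (z * w) * a * (z * w) - l • (1 : A) = star w * (star z * a * z - l • (1 : A)) * w := by
    rw [mul_sub, sub_mul]
    congr 1
    · simp [star_mul, mul_assoc]
    · rw [mul_smul_comm, mul_one, smul_mul_assoc, hw]
  rw [this]
  exact isom_conj_norm_le _ _ hw

lemma exists_compress (hpi : ∀ a : A, a ≠ 0 → ∃ x y : A, x * a * y = 1) [Nontrivial A]
    (a : A) (ε : ℝ) (hε : 0 < ε) :
    ∃ z : A, star z * z = 1 ∧ ∃ l : ℂ, ‖star z * a * z - l • (1 : A)‖ ≤ ε := by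
  obtain ⟨z, hz, l, hl⟩ := exists_compress_sa hpi (realPart a : A) (realPart a).2 (ε/2) (by positivity)
  obtain ⟨w, hw, m, hm⟩ := exists_compress_sa hpi (star z * (imaginaryPart a : A) * z)
    (by
      have := (imaginaryPart a).2.conjugate' z
      exact this) (ε/2) (by positivity)
  refine ⟨z * w, isom_mul z w hz hw, l + Complex.I * m, ?_⟩
  have h1 := (compress_mul z w (realPart a : A) hw l).trans hl
  have h2 : star (z * w) * a * (z * w) - (l + Complex.I * m) • (1 : A)
      = (star (z * w) * (realPart a : A) * (z * w) - l • (1 : A))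
        + Complex.I • (star w * (star z * (imaginaryPart a : A) * z) * w - m • (1 : A)) := by
    conv_lhs => rw [← realPart_add_I_smul_imaginaryPart a]
    simp only [star_mul, mul_add, add_mul, mul_smul_comm, smul_mul_assoc, smul_sub, add_smul,
      mul_assoc, smul_smul]
    abel
  rw [h2]
  refine (norm_add_le _ _).trans ?_
  rw [norm_smul, Complex.norm_I, one_mul]
  linarith

lemma exists_compress_finset (hpi : ∀ a : A, a ≠ 0 → ∃ x y : A, x * a * y = 1) [Nontrivial A]
    (F : Finset A) (ε : ℝ) (hε : 0 < ε) :
    ∃ z : A, star z * z = 1 ∧ ∀ a ∈ F, ∃ l : ℂ, ‖star z * a * z - l • (1 : A)‖ ≤ ε := by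
  classical
  induction F using Finset.induction_on with
  | empty => exact ⟨1, by simp, by simp⟩
  | insert a F _ ih =>
    obtain ⟨z, hz, hF⟩ := ih
    obtain ⟨w, hw, l, hl⟩ := exists_compress hpi (star z * a * z) ε hε
    refine ⟨z * w, isom_mul z w hz hw, ?_⟩
    intro b hb
    rcases Finset.mem_insert.1 hb with rfl | hb
    · refine ⟨l, ?_⟩
      convert hl using 2
      simp [star_mul, mul_assoc]
    · obtain ⟨m, hm⟩ := hF b hb
      exact ⟨m, (compress_mul z w b hw m).trans hm⟩

end basics
end KbProof

namespace KbProof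

section state
variable {A : Type} [CStarAlgebra A]
open Filter Topology

lemma exists_state (hpi : ∀ a : A, a ≠ 0 → ∃ x y : A, x * a * y = 1) [Nontrivial A]
    [TopologicalSpace.SeparableSpace A] :
    ∃ (f : A →ₗ[ℂ] ℂ) (Z : ℕ → A), (∀ n, star (Z n) * Z n = 1) ∧
      ∀ a, Tendsto (fun n => star (Z n) * a * Z n) atTop (𝓝 (f a • (1 : A))) := by
  classical
  let d : ℕ → A := TopologicalSpace.denseSeq A
  have hd : DenseRange d := TopologicalSpace.denseRange_denseSeq A
  choose! c hc1 hc2 using fun (F : Finset A) (ε : ℝ) (hε : 0 < ε) =>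
    exists_compress_finset hpi F ε hε
  let Z : ℕ → A := fun n => Nat.rec (1 : A)
    (fun n z => z * c ((Finset.range (n + 1)).image (fun i => star z * d i * z)) (1 / ((n : ℝ) + 1))) n
  have hZs : ∀ n, Z (n + 1) = Z n *
      c ((Finset.range (n + 1)).image (fun i => star (Z n) * d i * Z n)) (1 / ((n : ℝ) + 1)) :=
    fun n => rfl
  have hpos : ∀ n : ℕ, 0 < 1 / ((n : ℝ) + 1) := fun n => by positivity
  have hZ : ∀ n, star (Z n) * Z n = 1 := by
    intro n
    induction n with
    | zero => simp [Z]
    | succ n ih => rw [hZs]; exact isom_mul _ _ ih (hc1 _ _ (hpos n))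
  have hdl : ∀ n, ∀ i ≤ n, ∃ l : ℂ, ‖star (Z (n+1)) * d i * Z (n+1) - l • (1:A)‖
      ≤ 1 / ((n : ℝ) + 1) := by
    intro n i hi
    obtain ⟨l, hl⟩ := hc2 ((Finset.range (n + 1)).image (fun i => star (Z n) * d i * Z n)) _
      (hpos n) (star (Z n) * d i * Z n)
      (Finset.mem_image.2 ⟨i, Finset.mem_range.2 (by omega), rfl⟩)
    refine ⟨l, ?_⟩
    rw [hZs]
    convert hl using 2
    simp [star_mul, mul_assoc]
  have hmono : ∀ (a : A) (l : ℂ) (n k : ℕ), ‖star (Z (n+k)) * a * Z (n+k) - l • (1:A)‖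
      ≤ ‖star (Z n) * a * Z n - l • (1:A)‖ := by
    intro a l n k
    induction k with
    | zero => simp
    | succ k ih =>
      rw [← add_assoc, hZs]
      exact (compress_mul _ _ _ (hc1 _ _ (hpos _)) l).trans ih
  have happ : ∀ (a : A) (ε : ℝ), 0 < ε → ∃ N, ∃ l : ℂ, ∀ n ≥ N,
      ‖star (Z n) * a * Z n - l • (1:A)‖ ≤ ε := by
    intro a ε hε
    obtain ⟨i, hi⟩ := hd.exists_dist_lt a (half_pos hε)
    obtain ⟨m, hm⟩ := exists_nat_one_div_lt (half_pos hε)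
    obtain ⟨l, hl⟩ := hdl (max m i) i (le_max_right _ _)
    refine ⟨max m i + 1, l, fun n hn => ?_⟩
    obtain ⟨k, rfl⟩ := Nat.exists_eq_add_of_le hn
    have h1 := hmono (d i) l (max m i + 1) k
    have h2 : ‖star (Z (max m i + 1 + k)) * (a - d i) * Z (max m i + 1 + k)‖ ≤ ε / 2 := by
      refine (isom_conj_norm_le _ _ (hZ _)).trans ?_
      rw [dist_eq_norm] at hi
      exact hi.le
    have h3 : 1 / (((max m i : ℕ) : ℝ) + 1) ≤ 1 / ((m : ℝ) + 1) := by
      gcongr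
      exact le_max_left _ _
    have h4 : star (Z (max m i + 1 + k)) * a * Z (max m i + 1 + k) - l • (1:A)
       = star (Z (max m i + 1 + k)) * (a - d i) * Z (max m i + 1 + k)
        + (star (Z (max m i + 1 + k)) * (d i) * Z (max m i + 1 + k) - l • (1:A)) := by
      simp only [mul_sub, sub_mul]; abel
    rw [h4]
    refine (norm_add_le _ _).trans ?_
    linarith
  have hconv : ∀ a : A, ∃ l : ℂ, Tendsto (fun n => star (Z n) * a * Z n) atTop (𝓝 (l • (1 : A))) := by
    intro a
    have hcs : CauchySeq (fun n => star (Z n) * a * Z n) := by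
      rw [Metric.cauchySeq_iff']
      intro ε hε
      obtain ⟨N, l, hN⟩ := happ a (ε/3) (by positivity)
      refine ⟨N, fun n hn => ?_⟩
      have h1 := hN n hn
      have h2 := hN N le_rfl
      rw [dist_eq_norm]
      have h3 := norm_sub_le (star (Z n) * a * Z n - l • (1:A)) (star (Z N) * a * Z N - l • (1:A))
      rw [sub_sub_sub_cancel_right] at h3
      linarith
    obtain ⟨L, hL⟩ := cauchySeq_tendsto_of_complete hcs
    have hcl : IsClosed ((Submodule.span ℂ {(1:A)} : Submodule ℂ A) : Set A) :=
      Submodule.closed_of_finiteDimensional _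
    have hmem : L ∈ ((Submodule.span ℂ {(1:A)} : Submodule ℂ A) : Set A) := by
      rw [← hcl.closure_eq, Metric.mem_closure_iff]
      intro ε hε
      obtain ⟨N, l, hN⟩ := happ a (ε/2) (by positivity)
      refine ⟨l • 1, Submodule.smul_mem _ _ (Submodule.mem_span_singleton_self _), ?_⟩
      have h1 : ‖L - l • (1:A)‖ ≤ ε/2 := by
        refine le_of_tendsto (hL.sub_const (l • (1:A))).norm ?_
        filter_upwards [eventually_ge_atTop N] with n hn using hN n hn
      rw [dist_eq_norm]; linarith
    obtain ⟨l, hl⟩ := Submodule.mem_span_singleton.1 hmem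
    exact ⟨l, by rw [hl]; exact hL⟩
  choose f hf using hconv
  have hinj : ∀ l m : ℂ, l • (1:A) = m • (1:A) → l = m := fun l m h =>
    smul_left_injective ℂ (one_ne_zero : (1:A) ≠ 0) h
  refine ⟨{ toFun := f, map_add' := ?_, map_smul' := ?_ }, Z, hZ, hf⟩
  · intro a b
    apply hinj
    refine tendsto_nhds_unique (hf (a + b)) ?_
    rw [add_smul]
    have := (hf a).add (hf b)
    refine this.congr (fun n => ?_)
    simp only [mul_add, add_mul]
  · intro c a
    apply hinj
    refine tendsto_nhds_unique (hf (c • a)) ?_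
    have := (hf a).const_smul c
    rw [smul_smul] at this
    refine this.congr (fun n => ?_)
    simp only [mul_smul_comm, smul_mul_assoc]

variable {f : A →ₗ[ℂ] ℂ} {Z : ℕ → A}

lemma state_star [Nontrivial A]
    (hf : ∀ a, Tendsto (fun n => star (Z n) * a * Z n) atTop (𝓝 (f a • (1 : A)))) (a : A) :
    f (star a) = star (f a) := by
  have h1 := (hf a).star
  have h2 : Tendsto (fun n => star (Z n) * star a * Z n) atTop (𝓝 (star (f a) • (1 : A))) := by
    rw [star_smul, star_one] at h1
    refine h1.congr (fun n => ?_)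
    simp [star_mul, mul_assoc]
  exact smul_left_injective ℂ (one_ne_zero : (1:A) ≠ 0) (tendsto_nhds_unique (hf (star a)) h2)

lemma state_nonneg [Nontrivial A]
    (hf : ∀ a, Tendsto (fun n => star (Z n) * a * Z n) atTop (𝓝 (f a • (1 : A)))) (a : A) :
    0 ≤ (f (star a * a)).re := by
  letI : PartialOrder A := CStarAlgebra.spectralOrder A
  letI : StarOrderedRing A := CStarAlgebra.spectralOrderedRing A
  have h0 : (0:A) ≤ f (star a * a) • (1:A) := by
    refine ge_of_tendsto' (hf (star a * a)) (fun n => ?_)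
    have : star (Z n) * (star a * a) * Z n = star (a * Z n) * (a * Z n) := by
      simp [star_mul, mul_assoc]
    rw [this]; exact star_mul_self_nonneg _
  have him : f (star a * a) = ((f (star a * a)).re : ℂ) := by
    have := state_star hf (star a * a)
    rw [star_mul, star_star] at this
    exact (Complex.conj_eq_iff_re.1 this.symm).symm
  rw [him] at h0
  have h1 : ((f (star a * a)).re) ∈ spectrum ℝ (((f (star a * a)).re : ℂ) • (1:A)) := by
    have : (((f (star a * a)).re : ℂ) • (1:A)) = algebraMap ℝ A (f (star a * a)).re := by
      rw [Algebra.algebraMap_eq_smul_one]; simp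
    rw [this, spectrum.scalar_eq]; rfl
  exact spectrum_nonneg_of_nonneg h0 h1

lemma state_ne_zero [Nontrivial A] (hZ : ∀ n, star (Z n) * Z n = 1)
    (hf : ∀ a, Tendsto (fun n => star (Z n) * a * Z n) atTop (𝓝 (f a • (1 : A)))) (x b : A)
    (hx : x * b = 1) : f (star b * b) ≠ 0 := by
  intro h0
  have h1 := (hf (star b * b)).norm
  rw [h0, zero_smul, norm_zero] at h1
  have h2 : ∀ n, 1 ≤ ‖x‖ ^ 2 * ‖star (Z n) * (star b * b) * Z n‖ := by
    intro n
    have e1 : star (Z n) * (star b * b) * Z n = star (b * Z n) * (b * Z n) := by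
      simp [star_mul, mul_assoc]
    have e2 : Z n = x * (b * Z n) := by rw [← mul_assoc, hx, one_mul]
    have e3 : ‖Z n‖ * ‖Z n‖ = 1 := by rw [← CStarRing.norm_star_mul_self, hZ, norm_one]
    have e4 : ‖Z n‖ ≤ ‖x‖ * ‖b * Z n‖ := by conv_lhs => rw [e2]
                                            exact norm_mul_le _ _
    rw [e1, CStarRing.norm_star_mul_self]
    nlinarith [norm_nonneg (Z n), norm_nonneg x, norm_nonneg (b * Z n)]
  have h3 := ge_of_tendsto' (h1.const_mul (‖x‖^2)) h2
  norm_num at h3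

end state
end KbProof

namespace KbProof

section cp
variable {A : Type} [CStarAlgebra A]
open Filter Topology

lemma cp_star {n : ℕ} (φ : A →ₗ[ℂ] Matrix (Fin n) (Fin n) ℂ) (hφ : IsCompletelyPositive φ) (a : A) :
    φ (star a) = star (φ a) := by
  have hpos : ∀ b : A, IsSelfAdjoint (φ (star b * b)) := by
    intro b
    obtain ⟨N', hN'⟩ := hφ 1 (Matrix.of (fun _ _ => star b * b)) ⟨Matrix.of (fun _ _ => b), by
      ext i j; simp [Matrix.mul_apply, Matrix.conjTranspose_apply]⟩
    have := congrFun (congrFun hN' 0) 0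
    simp only [Matrix.map_apply, Matrix.of_apply, Matrix.mul_apply, Matrix.conjTranspose_apply,
      Finset.univ_unique, Fin.default_eq_zero, Finset.sum_singleton] at this
    rw [this]
    exact IsSelfAdjoint.star_mul_self _
  have hre : ∀ b : A, IsSelfAdjoint (φ b + φ (star b)) := by
    intro b
    have h1 := hpos (1 + b)
    have h2 := hpos b
    have h3 := hpos 1
    have e : φ b + φ (star b) = φ (star (1 + b) * (1 + b)) - φ (star b * b) - φ (star (1:A) * 1) := by
      rw [← map_add, ← map_sub, ← map_sub]
      congr 1
      simp only [star_add, star_one, add_mul, mul_add, one_mul, mul_one]; abel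
    rw [e]
    exact (h1.sub h2).sub h3
  have h1 := (hre a).star_eq
  have h2 := (hre (Complex.I • a)).star_eq
  simp only [star_smul, map_smul, star_add, Complex.star_def, Complex.conj_I] at h1 h2
  simp only [map_neg, neg_smul, map_smul, star_neg, star_smul, Complex.star_def, Complex.conj_I] at h2
  have h3 : Complex.I • (star (φ (star a)) - φ a) = Complex.I • (star (φ a) - φ (star a)) := by
    simp only [smul_sub]
    simp only [neg_neg] at h2
    linear_combination (norm := module) h2
  have h4 := smul_right_injective (Matrix (Fin n) (Fin n) ℂ) Complex.I_ne_zero h3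
  have h5 : (2:ℂ) • φ (star a) = (2:ℂ) • star (φ a) := by
    rw [two_smul, two_smul]
    linear_combination (norm := module) h4 - h1
  exact smul_right_injective _ (two_ne_zero) h5

variable {f : A →ₗ[ℂ] ℂ} {Z : ℕ → A}

lemma exists_neg_part {B : Type} [CStarAlgebra B] (y : B) (hy : IsSelfAdjoint y) :
    ∃ k m N : B, IsSelfAdjoint k ∧ IsSelfAdjoint m ∧ IsSelfAdjoint N ∧
      k * y * k = -(m * m) ∧ N * N = y + m := by
  let sn : ℝ → ℝ := fun t => Real.sqrt (max (-t) 0)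
  let ng : ℝ → ℝ := fun t => max (-t) 0
  let sp : ℝ → ℝ := fun t => Real.sqrt (max t 0)
  have c1 : Continuous sn := by fun_prop
  have c2 : Continuous ng := by fun_prop
  have c3 : Continuous sp := by fun_prop
  set k := cfc sn y with hk
  set m := cfc ng y with hm
  set N := cfc sp y with hN
  have hks : IsSelfAdjoint k := cfc_predicate _ _
  have hms : IsSelfAdjoint m := cfc_predicate _ _
  have hNs : IsSelfAdjoint N := cfc_predicate _ _
  have hkk : k * y * k = - (m * m) := by
    conv_lhs => rw [← cfc_id' ℝ y]
    rw [hk, hm, ← cfc_mul sn _ y c1.continuousOn (by fun_prop),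
      ← cfc_mul _ sn y (by fun_prop) c1.continuousOn, ← cfc_mul ng ng y c2.continuousOn c2.continuousOn,
      ← cfc_neg]
    apply cfc_congr
    intro t _
    simp only [sn, ng]
    rcases le_total 0 t with ht | ht
    · simp [max_eq_right (neg_nonpos.2 ht)]
    · rw [max_eq_left (neg_nonneg.2 ht)]
      have := Real.mul_self_sqrt (neg_nonneg.2 ht)
      linear_combination t * this
  have hNN : N * N = y + m := by
    conv_rhs => rw [← cfc_id' ℝ y]
    rw [hN, hm, ← cfc_mul sp sp y c3.continuousOn c3.continuousOn, ← cfc_add ..]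
    · apply cfc_congr
      intro t _
      simp only [sp, ng]
      rw [Real.mul_self_sqrt (le_max_right _ _)]
      rcases le_total 0 t with ht | ht
      · simp [max_eq_right (neg_nonpos.2 ht), max_eq_left ht]
      · simp [max_eq_left (neg_nonneg.2 ht), max_eq_right ht]
  exact ⟨k, m, N, hks, hms, hNs, hkk, hNN⟩

lemma matrix_pos [Nontrivial A] (hpi : ∀ a : A, a ≠ 0 → ∃ x y : A, x * a * y = 1)
    (hZ : ∀ n, star (Z n) * Z n = 1)
    (hf : ∀ a, Tendsto (fun n => star (Z n) * a * Z n) atTop (𝓝 (f a • (1 : A))))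
    {n : ℕ} (Y : Matrix (Fin n) (Fin n) A) (hY : Y.conjTranspose = Y)
    (h : ∀ c : Fin n → A, 0 ≤ (∑ i, ∑ j, f (star (c i) * Y i j * c j)).re) :
    ∃ N : Matrix (Fin n) (Fin n) A, Y = N.conjTranspose * N := by
  letI : PartialOrder A := CStarAlgebra.spectralOrder A
  letI : StarOrderedRing A := CStarAlgebra.spectralOrderedRing A
  let YC : CStarMatrix (Fin n) (Fin n) A := CStarMatrix.ofMatrix Y
  have hYC : IsSelfAdjoint YC := hY
  obtain ⟨k, m, N, hks, hms, hNs, hkk, hNN⟩ := exists_neg_part YC hYC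
  have hm0 : m = 0 := by
    ext i₀ p
    by_contra hne
    obtain ⟨x, y, hxy⟩ := hpi _ hne
    have e1 := h (fun i => k i p * y)
    have e2 : ∑ i, ∑ j, f (star (k i p * y) * Y i j * (k j p * y))
        = f (star y * (k * YC * k) p p * y) := by
      have hkst : ∀ i j, star (k i j) = k j i := by
        intro i j
        exact congrFun (congrFun hks.star_eq j) i
      rw [CStarMatrix.mul_apply]
      simp only [CStarMatrix.mul_apply, Finset.mul_sum, Finset.sum_mul, map_sum, star_mul, hkst]
      rw [Finset.sum_comm]
      refine Finset.sum_congr rfl fun i _ => Finset.sum_congr rfl fun j _ => ?_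
      congr 1
      simp only [YC, mul_assoc]
      rfl
    have e3 : f (star y * (k * YC * k) p p * y) = - ∑ i, f (star (m i p * y) * (m i p * y)) := by
      have hmst : ∀ i j, star (m i j) = m j i := by
        intro i j
        exact congrFun (congrFun hms.star_eq j) i
      rw [hkk]
      have : (-(m * m)) p p = - ∑ i, m p i * m i p := by
        rw [← CStarMatrix.mul_apply]; rfl
      rw [this]
      simp only [mul_neg, neg_mul, map_neg, Finset.mul_sum, Finset.sum_mul, map_sum, star_mul, hmst,
        mul_assoc]
    rw [e2, e3] at e1
    simp only [Complex.neg_re, Complex.re_sum] at e1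
    have e4 : ∀ i ∈ Finset.univ, 0 ≤ (f (star (m i p * y) * (m i p * y))).re :=
      fun i _ => state_nonneg hf _
    have e5 := Finset.single_le_sum e4 (Finset.mem_univ i₀)
    have e6 := state_ne_zero hZ hf x (m i₀ p * y) (by rw [← mul_assoc]; exact hxy)
    apply e6
    have e7 := state_star hf (star (m i₀ p * y) * (m i₀ p * y))
    rw [star_mul, star_star] at e7
    rw [← Complex.conj_eq_iff_re.1 e7.symm]
    have := e4 i₀ (Finset.mem_univ _)
    have e8 : (f (star (m i₀ p * y) * (m i₀ p * y))).re = 0 := by linarith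
    rw [e8]; simp
  rw [hm0, add_zero] at hNN
  refine ⟨CStarMatrix.ofMatrix.symm N, ?_⟩
  have : Y = CStarMatrix.ofMatrix.symm (star N * N) := by rw [hNs.star_eq, hNN]; rfl
  rw [this]; rfl

lemma cp_pairing {n : ℕ} (φ : A →ₗ[ℂ] Matrix (Fin n) (Fin n) ℂ) (hφ : IsCompletelyPositive φ)
    (N : Matrix (Fin n) (Fin n) A) :
    0 ≤ (∑ i, ∑ j, φ ((N.conjTranspose * N) i j) i j).re := by
  obtain ⟨N', hN'⟩ := hφ n (N.conjTranspose * N) ⟨N, rfl⟩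
  have h1 : ∀ i j, φ ((N.conjTranspose * N) i j) i j
      = ∑ k, ∑ l, star (N' k i l i) * N' k j l j := by
    intro i j
    have := congrFun (congrFun hN' i) j
    rw [Matrix.map_apply] at this
    rw [this, Matrix.mul_apply, Matrix.sum_apply]
    refine Finset.sum_congr rfl fun k _ => ?_
    rw [Matrix.mul_apply]
    rfl
  have h2 : ∑ i, ∑ j, φ ((N.conjTranspose * N) i j) i j
      = ∑ k, ∑ l, star (∑ i, N' k i l i) * (∑ j, N' k j l j) := by
    simp only [h1, star_sum, Finset.sum_mul_sum]
    calc ∑ i, ∑ j, ∑ k, ∑ l, star (N' k i l i) * N' k j l j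
        = ∑ i, ∑ k, ∑ l, ∑ j, star (N' k i l i) * N' k j l j := by
          refine Finset.sum_congr rfl fun i _ => ?_
          rw [Finset.sum_comm]
          refine Finset.sum_congr rfl fun k _ => ?_
          rw [Finset.sum_comm]
      _ = _ := by
          rw [Finset.sum_comm]
          refine Finset.sum_congr rfl fun k _ => ?_
          rw [Finset.sum_comm]
  rw [h2]
  simp only [Complex.re_sum]
  refine Finset.sum_nonneg fun k _ => Finset.sum_nonneg fun l _ => ?_
  rw [Complex.star_def, ← Complex.normSq_eq_conj_mul_self, Complex.ofReal_re]
  exact Complex.normSq_nonneg _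

lemma cp_pairing_nonneg [Nontrivial A] (hpi : ∀ a : A, a ≠ 0 → ∃ x y : A, x * a * y = 1)
    (hZ : ∀ n, star (Z n) * Z n = 1)
    (hf : ∀ a, Tendsto (fun n => star (Z n) * a * Z n) atTop (𝓝 (f a • (1 : A))))
    {n : ℕ} (φ : A →ₗ[ℂ] Matrix (Fin n) (Fin n) ℂ) (hφ : IsCompletelyPositive φ)
    (X : Fin n → Fin n → A)
    (h : ∀ c : Fin n → A, 0 ≤ (∑ i, ∑ j, f (star (c i) * X i j * c j)).re) :
    0 ≤ (∑ i, ∑ j, φ (X i j) i j).re := by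
  let Y : Matrix (Fin n) (Fin n) A := fun i j => X i j + star (X j i)
  have hY : Y.conjTranspose = Y := by
    ext i j
    change star (X j i + star (X i j)) = X i j + star (X j i)
    simp [add_comm]
  obtain ⟨N, hN⟩ := matrix_pos hpi hZ hf Y hY (by
    intro c
    have e : ∑ i, ∑ j, f (star (c i) * Y i j * c j) = ∑ i, ∑ j, f (star (c i) * X i j * c j)
        + star (∑ i, ∑ j, f (star (c i) * X i j * c j)) := by
      simp only [Y, mul_add, add_mul, map_add, Finset.sum_add_distrib, star_sum]
      congr 1
      rw [Finset.sum_comm]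
      refine Finset.sum_congr rfl fun i _ => Finset.sum_congr rfl fun j _ => ?_
      rw [← state_star hf]
      simp [star_mul, mul_assoc]
    rw [e]
    have := h c
    simp only [Complex.add_re, Complex.star_def, Complex.conj_re]
    linarith)
  have h1 := cp_pairing φ hφ N
  rw [← hN] at h1
  have e : ∑ i, ∑ j, φ (Y i j) i j = ∑ i, ∑ j, φ (X i j) i j
        + star (∑ i, ∑ j, φ (X i j) i j) := by
    simp only [Y, map_add, Matrix.add_apply, Finset.sum_add_distrib, star_sum, cp_star φ hφ]
    congr 1
    rw [Finset.sum_comm]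
    rfl
  rw [e] at h1
  simp only [Complex.add_re, Complex.star_def, Complex.conj_re] at h1
  linarith

end cp
end KbProof

namespace KbProof

section cpapprox
variable {A : Type} [CStarAlgebra A]
open Filter Topology
variable {f : A →ₗ[ℂ] ℂ} {Z : ℕ → A}

lemma cp_factor [Nontrivial A] (hpi : ∀ a : A, a ≠ 0 → ∃ x y : A, x * a * y = 1)
    (hZ : ∀ n, star (Z n) * Z n = 1)
    (hf : ∀ a, Tendsto (fun n => star (Z n) * a * Z n) atTop (𝓝 (f a • (1 : A))))
    {n : ℕ} (φ : A →ₗ[ℂ] Matrix (Fin n) (Fin n) ℂ) (hφ : IsCompletelyPositive φ)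
    {ι : Type} [Fintype ι] [DecidableEq ι] (a : ι → A) (ε : ℝ) (hε : 0 < ε) :
    ∃ (K : ℕ) (c : Fin K → Fin n → A), ∀ p i j,
      ‖φ (a p) i j - ∑ k, f (star (c k i) * a p * c k j)‖ < ε := by
  let V := ι × Fin n × Fin n → ℂ
  let g : (Fin n → A) → V := fun c p => f (star (c p.2.1) * a p.1 * c p.2.2)
  let C : Set V := {T | ∃ (K : ℕ) (c : Fin K → Fin n → A), T = ∑ k, g (c k)}
  have hg : ∀ (r : ℝ), 0 ≤ r → ∀ c, r • g c = g (fun i => ((Real.sqrt r : ℝ) : ℂ) • c i) := by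
    intro r hr c
    ext p
    change ((r : ℝ) : ℂ) * _ = _
    simp only [g, star_smul, Complex.star_def, Complex.conj_ofReal, smul_mul_assoc,
      mul_smul_comm, map_smul, smul_smul, smul_eq_mul]
    rw [← Complex.ofReal_mul, Real.mul_self_sqrt hr]
  have hsm : ∀ (r : ℝ), 0 ≤ r → ∀ T ∈ C, r • T ∈ C := by
    rintro r hr T ⟨K, c, rfl⟩
    refine ⟨K, fun k i => ((Real.sqrt r : ℝ) : ℂ) • c k i, ?_⟩
    rw [Finset.smul_sum]
    exact Finset.sum_congr rfl fun k _ => hg r hr _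
  have hadd : ∀ S ∈ C, ∀ T ∈ C, S + T ∈ C := by
    rintro S ⟨K, c, rfl⟩ T ⟨L, d, rfl⟩
    refine ⟨K + L, Fin.append c d, ?_⟩
    rw [Fin.sum_univ_add]
    simp
  have h0 : (0 : V) ∈ C := ⟨0, fun k => k.elim0, by simp⟩
  have hconv : Convex ℝ C := by
    intro x hx y hy s t hs ht _
    exact hadd _ (hsm s hs x hx) _ (hsm t ht y hy)
  let Φ : V := fun p => φ (a p.1) p.2.1 p.2.2
  have hcl : Φ ∈ closure C := by
    by_contra hne
    obtain ⟨ℓ, u, h1, h2⟩ := RCLike.geometric_hahn_banach_closed_point (𝕜 := ℂ) hconv.closure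
      isClosed_closure hne
    have hu : 0 < u := by simpa using h1 0 (subset_closure h0)
    have hneg : ∀ T ∈ C, (ℓ T).re ≤ 0 := by
      intro T hT
      by_contra! hpos
      have := h1 _ (subset_closure (hsm (u / (ℓ T).re) (by positivity) T hT))
      have e : ℓ ((u / (ℓ T).re) • T) = ((u / (ℓ T).re : ℝ) : ℂ) * ℓ T := by
        rw [show (u / (ℓ T).re) • T = ((u / (ℓ T).re : ℝ) : ℂ) • T from by
          ext p; rfl, map_smul, smul_eq_mul]
      rw [e] at this
      simp only [RCLike.re_eq_complex_re, Complex.re_ofReal_mul] at this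
      rw [div_mul_cancel₀ _ hpos.ne'] at this
      exact lt_irrefl _ this
    let x : ι × Fin n × Fin n → ℂ := fun p => ℓ (Pi.single p 1)
    have hx : ∀ T : V, ℓ T = ∑ p, x p * T p := by
      intro T
      have := LinearMap.pi_apply_eq_sum_univ (ℓ : V →ₗ[ℂ] ℂ) T
      simp only [ContinuousLinearMap.coe_coe, smul_eq_mul] at this
      rw [this]
      refine Finset.sum_congr rfl fun p _ => ?_
      rw [mul_comm]
      congr 2
      ext q
      simp [Pi.single_apply, eq_comm]
    let X : Fin n → Fin n → A := fun i j => - ∑ p, x (p, i, j) • a p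
    have hre : ∀ (T : V) , ℓ T = ∑ i, ∑ j, ∑ p, x (p, i, j) * T (p, i, j) := by
      intro T
      rw [hx, Fintype.sum_prod_type]
      simp only [Fintype.sum_prod_type]
      rw [Finset.sum_comm]
      refine Finset.sum_congr rfl fun i _ => ?_
      rw [Finset.sum_comm]
    have key := cp_pairing_nonneg hpi hZ hf φ hφ X (by
      intro c
      have hc := hneg (g c) ⟨1, fun _ => c, by simp⟩
      have e : ∑ i, ∑ j, f (star (c i) * X i j * c j) = - ℓ (g c) := by
        rw [hre]
        simp only [X, g, mul_neg, neg_mul, map_neg, Finset.sum_neg_distrib, Finset.mul_sum,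
          Finset.sum_mul, map_sum, mul_smul_comm, smul_mul_assoc, map_smul, smul_eq_mul]
      rw [e, Complex.neg_re]
      linarith)
    have e : ∑ i, ∑ j, φ (X i j) i j = - ℓ Φ := by
      rw [hre]
      simp only [X, Φ, map_neg, map_sum, map_smul, Matrix.neg_apply, Matrix.sum_apply,
        Matrix.smul_apply, smul_eq_mul, Finset.sum_neg_distrib]
    rw [e, Complex.neg_re] at key
    simp only [RCLike.re_eq_complex_re] at h2
    linarith
  obtain ⟨T, ⟨K, c, rfl⟩, hT⟩ := Metric.mem_closure_iff.1 hcl ε hε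
  refine ⟨K, c, fun p i j => ?_⟩
  have := (dist_pi_lt_iff hε).1 hT (p, i, j)
  rw [dist_eq_norm, Finset.sum_apply] at this
  exact this

end cpapprox
end KbProof

namespace KbProof

section isoms
variable {A : Type} [CStarAlgebra A]
open Filter Topology
variable {f : A →ₗ[ℂ] ℂ} {Z : ℕ → A}

lemma cp_matrix {n : ℕ} (ψ : Matrix (Fin n) (Fin n) ℂ →ₗ[ℂ] A) (hψ : IsCompletelyPositive ψ) :
    ∃ b : Fin n → Fin n → A, ∀ i j, ψ (Matrix.single i j 1) = ∑ l, star (b l i) * b l j := by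
  cases n with
  | zero => exact ⟨fun i => i.elim0, fun i => i.elim0⟩
  | succ n =>
    obtain ⟨N', hN'⟩ := hψ (n + 1) (Matrix.of fun i j => Matrix.single i j 1)
      ⟨Matrix.of fun k i => if k = 0 then Matrix.single 0 i 1 else 0, by
        refine Matrix.ext fun i j => ?_
        rw [Matrix.mul_apply]
        simp only [Matrix.conjTranspose_apply, Matrix.of_apply]
        rw [Finset.sum_eq_single 0]
        · simp [Matrix.star_eq_conjTranspose]
        · intro k _ hk; simp [hk]
        · simp⟩
    refine ⟨N', fun i j => ?_⟩
    have := congrFun (congrFun hN' i) j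
    simpa [Matrix.mul_apply, Matrix.conjTranspose_apply, Matrix.map_apply] using this

lemma exists_orth (s t : A) (hs : star s * s = 1) (ht : star t * t = 1) (hst : star s * t = 0) :
    ∃ T : ℕ → A, ∀ i j, star (T i) * T j = if i = j then 1 else 0 := by
  have hp : ∀ i : ℕ, star (t ^ i) * t ^ i = 1 := by
    intro i
    induction i with
    | zero => simp
    | succ i ih =>
      rw [pow_succ', star_mul, mul_assoc, ← mul_assoc (star t), ht, one_mul, ih]
  have hlt : ∀ i d : ℕ, star (t ^ i * s) * (t ^ (i + d + 1) * s) = 0 := by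
    intro i d
    rw [show i + d + 1 = i + (1 + d) by ring, pow_add, star_mul, mul_assoc (t ^ i), mul_assoc (star s),
      ← mul_assoc (star (t ^ i)), hp, one_mul, pow_add, pow_one, mul_assoc t, ← mul_assoc (star s),
      hst, zero_mul]
  refine ⟨fun i => t ^ i * s, fun i j => ?_⟩
  rcases lt_trichotomy i j with h | h | h
  · obtain ⟨d, rfl⟩ := Nat.exists_eq_add_of_lt h
    rw [hlt, if_neg h.ne]
  · subst h
    rw [if_pos rfl, star_mul, mul_assoc, ← mul_assoc (star (t ^ i)), hp, one_mul, hs]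
  · obtain ⟨d, rfl⟩ := Nat.exists_eq_add_of_lt h
    rw [if_neg h.ne', ← star_star (star _ * _), star_mul, star_star, hlt, star_zero]

lemma sum4_comm {α β M : Type} [AddCommMonoid M] [Fintype α] [Fintype β] (F : α → β → α → β → M) :
    ∑ x, ∑ y, ∑ z, ∑ w, F x y z w = ∑ z, ∑ w, ∑ x, ∑ y, F x y z w := by
  calc ∑ x, ∑ y, ∑ z, ∑ w, F x y z w = ∑ x, ∑ z, ∑ w, ∑ y, F x y z w := by
        refine Finset.sum_congr rfl fun x _ => ?_
        rw [Finset.sum_comm]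
        refine Finset.sum_congr rfl fun z _ => ?_
        rw [Finset.sum_comm]
    _ = _ := by
        rw [Finset.sum_comm]
        refine Finset.sum_congr rfl fun z _ => ?_
        rw [Finset.sum_comm]

lemma tendsto_gram (hf : ∀ a, Tendsto (fun n => star (Z n) * a * Z n) atTop (𝓝 (f a • (1 : A))))
    {J P : Type} [Fintype J] [DecidableEq J] [DecidableEq P] {n : ℕ}
    (c b : J → Fin n → A) (T : P × J → A)
    (hT : ∀ x y, star (T x) * T y = if x = y then 1 else 0) (p q : P) (a : A) :
    Tendsto (fun N => star (∑ κ, ∑ j, c κ j * Z N * T (p, κ) * b κ j) * a *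
      (∑ κ, ∑ j, c κ j * Z N * T (q, κ) * b κ j)) atTop
      (𝓝 (if p = q then ∑ κ, ∑ i, ∑ j, f (star (c κ i) * a * c κ j) • (star (b κ i) * b κ j) else 0)) := by
  have h1 : Tendsto (fun N => ∑ κ, ∑ i, ∑ κ', ∑ j, star (b κ i) * star (T (p, κ)) *
      (star (Z N) * (star (c κ i) * a * c κ' j) * Z N) * T (q, κ') * b κ' j) atTop
      (𝓝 (∑ κ, ∑ i, ∑ κ', ∑ j, star (b κ i) * star (T (p, κ)) *
      (f (star (c κ i) * a * c κ' j) • (1 : A)) * T (q, κ') * b κ' j)) := by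
    refine tendsto_finset_sum _ fun κ _ => tendsto_finset_sum _ fun i _ =>
      tendsto_finset_sum _ fun κ' _ => tendsto_finset_sum _ fun j _ => ?_
    exact (((hf _).const_mul _).mul_const _).mul_const _
  have e1 : ∑ κ, ∑ i, ∑ κ', ∑ j, star (b κ i) * star (T (p, κ)) *
      (f (star (c κ i) * a * c κ' j) • (1 : A)) * T (q, κ') * b κ' j
      = if p = q then ∑ κ, ∑ i, ∑ j, f (star (c κ i) * a * c κ j) • (star (b κ i) * b κ j) else 0 := by
    have e2 : ∀ κ i κ' j, star (b κ i) * star (T (p, κ)) *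
      (f (star (c κ i) * a * c κ' j) • (1 : A)) * T (q, κ') * b κ' j
      = if κ = κ' then (if p = q then f (star (c κ i) * a * c κ' j) • (star (b κ i) * b κ' j) else 0) else 0 := by
      intro κ i κ' j
      rw [mul_smul_comm, mul_one, smul_mul_assoc, mul_assoc (star (b κ i)), hT, smul_mul_assoc]
      by_cases h1 : p = q <;> by_cases h2 : κ = κ' <;> simp [h1, h2]
    simp only [e2]
    by_cases h : p = q
    · simp only [if_pos h]
      refine Finset.sum_congr rfl fun κ _ => Finset.sum_congr rfl fun i _ => ?_
      rw [Finset.sum_comm]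
      simp
    · simp [h]
  rw [← e1]
  refine h1.congr fun N => ?_
  simp only [star_sum, Finset.sum_mul, Finset.mul_sum, star_mul]
  simp only [mul_assoc]
  exact sum4_comm _


/-- Nuclearity gives approximately multiplicative-in-the-middle families. -/
lemma exists_gram [Nontrivial A] (hA : IsUnitalKirchberg A) (F : Finset A) (ε : ℝ) (hε : 0 < ε)
    (m : ℕ) : ∃ g : Fin m → A, ∀ a ∈ F, ∀ p q,
      ‖star (g p) * a * g q - (if p = q then a else 0)‖ < ε := by
  classical
  obtain ⟨f, Z, hZ, hf⟩ : ∃ (f : A →ₗ[ℂ] ℂ) (Z : ℕ → A), (∀ n, star (Z n) * Z n = 1) ∧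
      ∀ a, Tendsto (fun n => star (Z n) * a * Z n) atTop (𝓝 (f a • (1 : A))) := by
    have := hA.separable
    exact exists_state hA.purely_infinite
  obtain ⟨s, t, hs, ht, hst⟩ := hA.properly_infinite
  obtain ⟨T, hT⟩ := exists_orth s t hs ht hst
  obtain ⟨n, φ, ψ, hφ, hψ, hφψ⟩ := hA.nuclear F (ε / 2) (by positivity)
  obtain ⟨b, hb⟩ := cp_matrix ψ hψ
  set S : ℝ := ∑ i, ∑ j, ‖ψ (Matrix.single i j 1)‖ with hS
  have hS0 : 0 ≤ S := Finset.sum_nonneg fun i _ => Finset.sum_nonneg fun j _ => norm_nonneg _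
  obtain ⟨K, c, hc⟩ := cp_factor hA.purely_infinite hZ hf φ hφ (fun x : F => (x : A))
    (ε / 4 / (1 + S)) (by positivity)
  let c' : Fin K × Fin n → Fin n → A := fun κ => c κ.1
  let b' : Fin K × Fin n → Fin n → A := fun κ => b κ.2
  let e := Fintype.equivFin (Fin m × (Fin K × Fin n))
  let T' : Fin m × (Fin K × Fin n) → A := fun x => T (e x)
  have hT' : ∀ x y, star (T' x) * T' y = if x = y then 1 else 0 := by
    intro x y
    simp only [T', hT, Fin.val_inj, e.apply_eq_iff_eq]
  let τ : A → A := fun a => ∑ κ, ∑ i, ∑ j, f (star (c' κ i) * a * c' κ j) • (star (b' κ i) * b' κ j)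
  have hτ : ∀ a ∈ F, ‖τ a - a‖ < ε := by
    intro a ha
    have e1 : τ a = ∑ i, ∑ j, (∑ k, f (star (c k i) * a * c k j)) • ψ (Matrix.single i j 1) := by
      simp only [τ, c', b', hb, Fintype.sum_prod_type, Finset.sum_smul, Finset.smul_sum]
      calc _ = ∑ k, ∑ i, ∑ l, ∑ j, f (star (c k i) * a * c k j) • (star (b l i) * b l j) := by
            refine Finset.sum_congr rfl fun k _ => ?_
            rw [Finset.sum_comm]
        _ = ∑ i, ∑ k, ∑ j, ∑ l, f (star (c k i) * a * c k j) • (star (b l i) * b l j) := by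
            rw [Finset.sum_comm]
            refine Finset.sum_congr rfl fun i _ => Finset.sum_congr rfl fun k _ => ?_
            rw [Finset.sum_comm]
        _ = _ := by
            refine Finset.sum_congr rfl fun i _ => ?_
            rw [Finset.sum_comm]
            refine Finset.sum_congr rfl fun j _ => ?_
            rw [Finset.sum_comm]
    have e2 : ψ (φ a) = ∑ i, ∑ j, φ a i j • ψ (Matrix.single i j 1) := by
      conv_lhs => rw [Matrix.matrix_eq_sum_single (φ a)]
      simp only [map_sum]
      refine Finset.sum_congr rfl fun i _ => Finset.sum_congr rfl fun j _ => ?_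
      rw [← map_smul, Matrix.smul_single, smul_eq_mul, mul_one]
    have e3 : ‖ψ (φ a) - τ a‖ ≤ ε / 4 := by
      rw [e1, e2, ← Finset.sum_sub_distrib]
      simp only [← Finset.sum_sub_distrib, ← sub_smul]
      calc _ ≤ ∑ i, ∑ j, (ε / 4 / (1 + S)) * ‖ψ (Matrix.single i j 1)‖ := by
            refine (norm_sum_le _ _).trans (Finset.sum_le_sum fun i _ => ?_)
            refine (norm_sum_le _ _).trans (Finset.sum_le_sum fun j _ => ?_)
            rw [norm_smul]
            exact mul_le_mul_of_nonneg_right (hc ⟨a, ha⟩ i j).le (norm_nonneg _)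
        _ = (ε / 4 / (1 + S)) * S := by simp only [hS, Finset.mul_sum]
        _ ≤ ε / 4 := by
            rw [div_mul_eq_mul_div, div_le_iff₀ (by positivity)]
            nlinarith
    have e4 := hφψ a ha
    calc ‖τ a - a‖ = ‖(ψ (φ a) - a) - (ψ (φ a) - τ a)‖ := by congr 1; abel
      _ ≤ ‖ψ (φ a) - a‖ + ‖ψ (φ a) - τ a‖ := norm_sub_le _ _
      _ < ε := by linarith
  have key : ∀ᶠ N in atTop, ∀ a ∈ F, ∀ p q : Fin m,
      ‖star (∑ κ, ∑ j, c' κ j * Z N * T' (p, κ) * b' κ j) * a *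
      (∑ κ, ∑ j, c' κ j * Z N * T' (q, κ) * b' κ j) - (if p = q then a else 0)‖ < ε := by
    rw [Finset.eventually_all]
    intro a ha
    rw [eventually_all]
    intro p
    rw [eventually_all]
    intro q
    have h1 := (tendsto_gram hf c' b' T' hT' p q a).sub_const (if p = q then a else 0)
    refine h1.norm.eventually_lt_const ?_
    by_cases h : p = q
    · simp only [if_pos h]; exact hτ a ha
    · simpa only [if_neg h, sub_zero, norm_zero] using hε
  obtain ⟨N, hN⟩ := key.exists
  exact ⟨_, hN⟩

lemma gram_norm (g : A) (η : ℝ) (hη : η ≤ 1) (h : ‖star g * 1 * g - 1‖ < η) : ‖g‖ ≤ 2 := by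
  by_contra! hg
  have h1 : ‖star g * g‖ = ‖g‖ * ‖g‖ := CStarRing.norm_star_mul_self
  have h2 : ‖star g * g‖ ≤ ‖star g * 1 * g - 1‖ + ‖(1 : A)‖ := by
    rw [mul_one]
    simpa using norm_add_le (star g * g - 1) 1
  have h3 : ‖(1 : A)‖ ≤ 1 := isom_norm_le 1 (by simp)
  nlinarith

lemma gram_comm (g a : A) (η : ℝ) (h1 : ‖star g * 1 * g - 1‖ < η)
    (h2 : ‖star g * a * g - a‖ < η) (h3 : ‖star g * star a * g - star a‖ < η)
    (h4 : ‖star g * (star a * a) * g - star a * a‖ < η) :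
    ‖g * a - a * g‖ ^ 2 ≤ (‖a‖ + 1) ^ 2 * η := by
  have e : star (g * a - a * g) * (g * a - a * g) =
      star a * (star g * 1 * g - 1) * a - star a * (star g * a * g - a)
      - (star g * star a * g - star a) * a + (star g * (star a * a) * g - star a * a) := by
    simp only [star_sub, star_mul, mul_one, sub_mul, mul_sub, mul_assoc]
    abel
  rw [sq, ← CStarRing.norm_star_mul_self, e]
  have t1 : ‖star a * (star g * 1 * g - 1) * a‖ ≤ ‖a‖ * η * ‖a‖ := by
    refine (norm_mul_le _ _).trans (mul_le_mul_of_nonneg_right ?_ (norm_nonneg _))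
    refine (norm_mul_le _ _).trans ?_
    rw [norm_star]; gcongr
  have t2 : ‖star a * (star g * a * g - a)‖ ≤ ‖a‖ * η := by
    refine (norm_mul_le _ _).trans ?_
    rw [norm_star]; gcongr
  have t3 : ‖(star g * star a * g - star a) * a‖ ≤ η * ‖a‖ := by
    refine (norm_mul_le _ _).trans ?_
    gcongr
  have := norm_add_le (star a * (star g * 1 * g - 1) * a - star a * (star g * a * g - a)
      - (star g * star a * g - star a) * a) (star g * (star a * a) * g - star a * a)
  have := norm_sub_le (star a * (star g * 1 * g - 1) * a - star a * (star g * a * g - a))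
      ((star g * star a * g - star a) * a)
  have := norm_sub_le (star a * (star g * 1 * g - 1) * a) (star a * (star g * a * g - a))
  nlinarith

end isoms
end KbProof

namespace KbProof

section central
variable {A : Type} [CStarAlgebra A]
open Filter Topology

/-- Perturb an approximately orthonormal family to an exactly orthonormal one. -/
lemma orthonormalize [Nontrivial A] {m : ℕ} (T : Fin m → A)
    (hT : ∀ i j, star (T i) * T j = if i = j then 1 else 0)
    (g : Fin m → A) (η : ℝ) (hη : 0 ≤ η) (hm : (m : ℝ) * (m * η) ≤ 1 / 2)
    (hg : ∀ p q, ‖star (g p) * 1 * g q - (if p = q then 1 else 0)‖ < η) (hg2 : ∀ p, ‖g p‖ ≤ 2) :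
    ∃ s : Fin m → A, (∀ i j, star (s i) * s j = if i = j then 1 else 0) ∧
      ∀ i, ‖s i - g i‖ ≤ (m * 2) * (m * (m * η)) := by
  have hTn : ∀ i, ‖T i‖ ≤ 1 := fun i => isom_norm_le _ (by simp [hT])
  let G : A := ∑ i, g i * star (T i)
  let q : A := ∑ i, T i * star (T i)
  have hqT : ∀ j, q * T j = T j := by
    intro j
    simp only [q, Finset.sum_mul, mul_assoc, hT]
    simp
  have hGT : ∀ j, G * T j = g j := by
    intro j
    simp only [G, Finset.sum_mul, mul_assoc, hT]
    simp
  have hqs : star q = q := by simp [q, star_sum]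
  have hGq : G * q = G := by
    have : G * q = ∑ i, G * T i * star (T i) := by simp only [q, Finset.mul_sum, mul_assoc]
    rw [this]; simp only [hGT, G]
  have hqq : q * q = q := by
    have : q * q = ∑ i, q * T i * star (T i) := by
      conv_lhs => rw [show q * q = q * ∑ i, T i * star (T i) from rfl]
      simp only [Finset.mul_sum, mul_assoc]
    rw [this]; simp only [hqT, q]
  have hqG : q * star G = star G := by
    have := congrArg star hGq
    rwa [star_mul, hqs] at this
  let b : A := star G * G + 1 - q
  have hbs : IsSelfAdjoint b := by
    change star b = b
    simp [b, hqs]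
  have hb1 : b - 1 = ∑ i, ∑ j, T i * (star (g i) * 1 * g j - (if i = j then 1 else 0)) * star (T j) := by
    have e1 : star G * G = ∑ i, ∑ j, T i * (star (g i) * 1 * g j) * star (T j) := by
      simp only [G, star_sum, star_mul, star_star, Finset.sum_mul_sum, mul_one, mul_assoc]
    have e2 : q = ∑ i, ∑ j, T i * (if i = j then 1 else 0) * star (T j) := by
      simp [q]
    simp only [mul_sub, sub_mul, Finset.sum_sub_distrib]
    rw [← e1, ← e2]
    simp only [b]; abel
  have hbn : ‖b - 1‖ ≤ m * (m * η) := by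
    rw [hb1]
    calc _ ≤ ∑ i : Fin m, ∑ j : Fin m, η := by
          refine (norm_sum_le _ _).trans (Finset.sum_le_sum fun i _ => ?_)
          refine (norm_sum_le _ _).trans (Finset.sum_le_sum fun j _ => ?_)
          refine (norm_mul_le _ _).trans ?_
          rw [norm_star]
          refine (mul_le_of_le_one_right (norm_nonneg _) (hTn j)).trans ?_
          refine (norm_mul_le _ _).trans ?_
          exact (mul_le_of_le_one_left (norm_nonneg _) (hTn i)).trans (hg i j).le
      _ = _ := by simp
  have hspec : ∀ t ∈ spectrum ℝ b, 0 < t := by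
    intro t ht
    have h1 : t - 1 ∈ spectrum ℝ (b - 1) := by
      have h3 := (spectrum.add_mem_add_iff (R := ℝ) (a := b) (r := t) (s := -1)).2 ht
      simpa [sub_eq_add_neg, add_comm] using h3
    have h2 := spectrum.norm_le_norm_of_mem h1
    rw [Real.norm_eq_abs] at h2
    have := (abs_le.1 (h2.trans (hbn.trans hm))).1
    linarith
  obtain ⟨r, hr1, hr2, hr3, hr4⟩ := exists_invSqrt b hbs hspec
  have hbq : Commute b q := by
    change b * q = q * b
    simp only [b, sub_mul, add_mul, mul_sub, mul_add, one_mul, mul_one, hqq, mul_assoc, hGq]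
    rw [← mul_assoc, hqG]
  have hrq := hr3 q hbq
  have hrn := (hr4 (hbn.trans hm)).trans hbn
  refine ⟨fun i => G * r * T i, fun i j => ?_, fun i => ?_⟩
  · have e1 : star (G * r * T i) * (G * r * T j) = star (T i) * (r * b * r) * T j
        - star (T i) * r * ((1 - q) * r * T j) := by
      simp only [star_mul, hr1.star_eq, b]
      noncomm_ring
    have e2 : (1 - q) * r * T j = 0 := by
      rw [sub_mul, one_mul, ← hrq.eq, sub_mul, mul_assoc r, hqT, sub_self]
    rw [e1, e2, mul_zero, sub_zero, hr2, mul_one, hT]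
  · have e1 : G * r * T i - g i = G * (r - 1) * T i := by
      rw [← hGT i]; noncomm_ring
    have hGn : ‖G‖ ≤ m * 2 := by
      calc ‖G‖ ≤ ∑ i : Fin m, (2 : ℝ) := by
            refine (norm_sum_le _ _).trans (Finset.sum_le_sum fun i _ => ?_)
            refine (norm_mul_le _ _).trans ?_
            rw [norm_star]
            exact (mul_le_of_le_one_right (norm_nonneg _) (hTn i)).trans (hg2 i)
        _ = _ := by simp
    rw [e1]
    refine (norm_mul_le _ _).trans ?_
    refine (mul_le_of_le_one_right (norm_nonneg _) (hTn i)).trans ?_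
    refine (norm_mul_le _ _).trans ?_
    gcongr

/-- Asymptotically central isometries. -/
lemma exists_central [Nontrivial A] (hA : IsUnitalKirchberg A) (F : Finset A) (ε : ℝ) (hε : 0 < ε)
    (m : ℕ) : ∃ s : Fin m → A, (∀ i j, star (s i) * s j = if i = j then 1 else 0) ∧
      ∀ x ∈ F, ∀ i, ‖s i * x - x * s i‖ < ε := by
  classical
  obtain ⟨s, t, hs, ht, hst⟩ := hA.properly_infinite
  obtain ⟨T, hT⟩ := exists_orth s t hs ht hst
  obtain ⟨M, hM0, hM⟩ : ∃ M : ℝ, 0 ≤ M ∧ ∀ x ∈ F, ‖x‖ ≤ M := by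
    refine ⟨∑ x ∈ F, ‖x‖, Finset.sum_nonneg fun _ _ => norm_nonneg _, fun x hx => ?_⟩
    exact Finset.single_le_sum (f := fun x => ‖x‖) (fun _ _ => norm_nonneg _) hx
  -- choose η
  obtain ⟨η, hη, c1, c2, c3, c4⟩ : ∃ η : ℝ, 0 < η ∧ η ≤ 1 ∧ (m : ℝ) * (m * η) ≤ 1 / 2 ∧
      (M + 1) ^ 2 * η < (ε / 2) ^ 2 ∧ 2 * M * ((m * 2) * (m * (m * η))) < ε / 2 := by
    have h : ∀ (k d : ℝ), 0 < d → ∀ᶠ η in 𝓝[>] (0 : ℝ), k * η < d := by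
      intro k d hd
      have : Tendsto (fun η : ℝ => k * η) (𝓝[>] 0) (𝓝 (k * 0)) :=
        (continuous_const.mul continuous_id).continuousAt.tendsto.mono_left nhdsWithin_le_nhds
      rw [mul_zero] at this
      exact this.eventually_lt_const hd
    have := ((((h 1 1 one_pos).and (h (m * m) (1 / 2) (by norm_num))).and
      (h ((M + 1) ^ 2) ((ε / 2) ^ 2) (by positivity))).and
      (h (2 * M * (m * 2 * (m * m))) (ε / 2) (by positivity))).and self_mem_nhdsWithin
    obtain ⟨η, ⟨⟨⟨h1, h2⟩, h3⟩, h4⟩, h5⟩ := this.exists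
    exact ⟨η, h5, by linarith, by linarith, h3, by
      calc _ = 2 * M * (m * 2 * (m * m)) * η := by ring
        _ < _ := h4⟩
  obtain ⟨g, hg⟩ := exists_gram hA (insert 1 (F ∪ F.image star ∪ F.image (fun x => star x * x))) η hη m
  have hg1 := hg 1 (by simp)
  have hg2 : ∀ p, ‖g p‖ ≤ 2 := fun p => gram_norm (g p) η c1 (by simpa using hg1 p p)
  obtain ⟨s, hs1, hs2⟩ := orthonormalize (fun i : Fin m => T i) (by
    intro i j; rw [hT]; simp [Fin.val_inj]) g η hη.le c2 hg1 hg2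
  refine ⟨s, hs1, fun x hx i => ?_⟩
  have k1 := gram_comm (g i) x η (by simpa using hg1 i i)
    (by simpa using hg x (by simp [hx]) i i)
    (by simpa using hg (star x) (by simp [hx]) i i)
    (by simpa using hg (star x * x) (by
      simp only [Finset.mem_insert, Finset.mem_union, Finset.mem_image]
      exact Or.inr (Or.inr ⟨x, hx, rfl⟩)) i i)
  have hxM := hM x hx
  have k2 : ‖g i * x - x * g i‖ < ε / 2 := by
    refine lt_of_pow_lt_pow_left₀ 2 (by positivity) (k1.trans_lt (lt_of_le_of_lt ?_ c3))
    gcongr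
  have e : s i * x - x * s i = (g i * x - x * g i) + ((s i - g i) * x - x * (s i - g i)) := by
    noncomm_ring
  have k3 : ‖(s i - g i) * x - x * (s i - g i)‖ ≤ 2 * M * ((m * 2) * (m * (m * η))) := by
    refine (norm_sub_le _ _).trans ?_
    have a1 : ‖(s i - g i) * x‖ ≤ (m * 2) * (m * (m * η)) * M :=
      (norm_mul_le _ _).trans (mul_le_mul (hs2 i) hxM (norm_nonneg _) (by positivity))
    have a2 : ‖x * (s i - g i)‖ ≤ M * ((m * 2) * (m * (m * η))) :=
      (norm_mul_le _ _).trans (mul_le_mul hxM (hs2 i) (norm_nonneg _) hM0)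
    linarith
  rw [e]
  refine (norm_add_le _ _).trans_lt ?_
  linarith

end central
end KbProof

namespace KbProof

section key
variable {A : Type} [CStarAlgebra A]
open Filter Topology

/-- The permutation-type unitary attached to an orthonormal family of isometries. -/
noncomputable def shiftU {ι : Type} [Fintype ι] (σ : Equiv.Perm ι) (s y : ι → A) : A :=
  1 - ∑ k, s k * star (s k) + ∑ k, s (σ k) * y k * star (s k)

variable {ι : Type} [Fintype ι] [DecidableEq ι]

lemma orth_sum_mul (s : ι → A) (hs : ∀ i j, star (s i) * s j = if i = j then 1 else 0)
    (σ : Equiv.Perm ι) (y : ι → A) (j : ι) :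
    (∑ k, s (σ k) * y k * star (s k)) * s j = s (σ j) * y j := by
  simp only [Finset.sum_mul, mul_assoc, hs]
  simp

lemma shiftU_apply (s : ι → A) (hs : ∀ i j, star (s i) * s j = if i = j then 1 else 0)
    (σ : Equiv.Perm ι) (y : ι → A) (j : ι) : shiftU σ s y * s j = s (σ j) * y j := by
  have h := orth_sum_mul s hs 1 (fun _ => 1) j
  simp only [mul_one, Equiv.Perm.coe_one, id] at h
  rw [shiftU, add_mul, sub_mul, h, orth_sum_mul s hs σ y j]
  simp

lemma shiftU_unitary (s : ι → A) (hs : ∀ i j, star (s i) * s j = if i = j then 1 else 0)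
    (σ : Equiv.Perm ι) (y : ι → A) (hy : ∀ i, y i ∈ unitary A) : shiftU σ s y ∈ unitary A := by
  set q : A := ∑ k, s k * star (s k) with hq
  set W : A := ∑ k, s (σ k) * y k * star (s k) with hW
  have hWs : ∀ j, W * s j = s (σ j) * y j := orth_sum_mul s hs σ y
  have hqs : ∀ j, q * s j = s j := by
    intro j
    have h := orth_sum_mul s hs 1 (fun _ => 1) j
    simpa only [mul_one, Equiv.Perm.coe_one, id] using h
  have q1 : star q = q := by simp [hq, star_sum]
  have q2 : q * q = q := by
    have : q * q = ∑ i, q * s i * star (s i) := by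
      conv_lhs => rw [show q * q = q * ∑ i, s i * star (s i) from rfl]
      simp only [Finset.mul_sum, mul_assoc]
    rw [this]; simp only [hqs]; rfl
  have q3 : W * q = W := by
    have : W * q = ∑ i, W * s i * star (s i) := by
      simp only [hq, Finset.mul_sum, mul_assoc]
    rw [this]; simp only [hWs]; rfl
  have q4 : q * W = W := by
    simp only [hW, Finset.mul_sum, ← mul_assoc, hqs]
  have q5 : star W * W = q := by
    have e : star W = ∑ k, s k * star (y k) * star (s (σ k)) := by
      simp [hW, star_sum, mul_assoc]
    have : star W * W = ∑ i, star W * s (σ i) * (y i * star (s i)) := by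
      conv_lhs => rw [show star W * W = star W * ∑ k, s (σ k) * y k * star (s k) from rfl]
      simp only [Finset.mul_sum, mul_assoc]
    rw [this]
    simp only [hq]
    refine Finset.sum_congr rfl fun i _ => ?_
    have e2 : star W * s (σ i) = s i * star (y i) := by
      rw [e]; simp only [Finset.sum_mul, mul_assoc, hs]; simp
    rw [e2, mul_assoc, ← mul_assoc (star (y i)), Unitary.star_mul_self_of_mem (hy i), one_mul]
  have q6 : W * star W = q := by
    have e : star W = ∑ k, s k * (star (y k) * star (s (σ k))) := by
      simp [hW, star_sum, mul_assoc]
    conv_lhs => rw [e]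
    rw [Finset.mul_sum]
    simp only [← mul_assoc, hWs]
    simp only [mul_assoc]
    rw [hq, ← Equiv.sum_comp σ (fun k => s k * star (s k))]
    refine Finset.sum_congr rfl fun i _ => ?_
    rw [← mul_assoc (y i), Unitary.mul_star_self_of_mem (hy i), one_mul]
  have q3' : q * star W = star W := by
    have := congrArg star q3; rwa [star_mul, q1] at this
  have q4' : star W * q = star W := by
    have := congrArg star q4; rwa [star_mul, q1] at this
  have e : shiftU σ s y = 1 - q + W := rfl
  rw [e, Unitary.mem_iff]
  simp only [star_add, star_sub, star_one, q1]
  constructor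
  · simp only [add_mul, mul_add, sub_mul, mul_sub, one_mul, mul_one, q2, q3, q4, q5, q6, q3', q4']
    abel
  · simp only [add_mul, mul_add, sub_mul, mul_sub, one_mul, mul_one, q2, q3, q4, q5, q6, q3', q4']
    abel

lemma orth_sum_norm (s : ι → A) (hs : ∀ i j, star (s i) * s j = if i = j then 1 else 0)
    (σ : Equiv.Perm ι) (x : ι → A) (ρ : ℝ) (hρ : 0 ≤ ρ) (hx : ∀ i, ‖x i‖ ≤ ρ) :
    ‖∑ k, s (σ k) * x k * star (s k)‖ ≤ ρ := by
  let π : (ι → A) →⋆ₙₐ[ℂ] A :=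
    { toFun := fun x => ∑ k, s k * x k * star (s k)
      map_smul' := by intro c x; simp [Finset.smul_sum]
      map_zero' := by simp
      map_add' := by intro x y; simp [mul_add, add_mul, Finset.sum_add_distrib]
      map_mul' := by
        intro x y
        have h : (∑ k, s k * x k * star (s k)) * (∑ k, s k * y k * star (s k)) =
            ∑ j, (∑ k, s k * x k * star (s k)) * s j * (y j * star (s j)) := by
          rw [Finset.mul_sum]; simp only [mul_assoc]
        rw [h]
        refine Finset.sum_congr rfl fun j _ => ?_
        have := orth_sum_mul s hs 1 x j
        simp only [Equiv.Perm.coe_one, id] at this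
        rw [this]; simp [mul_assoc]
      map_star' := by intro x; simp [star_sum, mul_assoc] }
  set W := ∑ k, s (σ k) * x k * star (s k) with hW
  have e : star W * W = π (star x * x) := by
    have h : star W * W = ∑ i, star W * s (σ i) * (x i * star (s i)) := by
      conv_lhs => rw [show star W * W = star W * ∑ k, s (σ k) * x k * star (s k) from rfl]
      simp only [Finset.mul_sum, mul_assoc]
    rw [h]
    refine Finset.sum_congr rfl fun i _ => ?_
    have e2 : star W * s (σ i) = s i * star (x i) := by
      have e : star W = ∑ k, s k * star (x k) * star (s (σ k)) := by
        simp [hW, star_sum, mul_assoc]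
      rw [e]; simp only [Finset.sum_mul, mul_assoc, hs]; simp
    rw [e2]; simp [mul_assoc]
  have h1 : ‖W‖ * ‖W‖ ≤ ρ * ρ := by
    rw [← CStarRing.norm_star_mul_self, e]
    refine (NonUnitalStarAlgHom.norm_apply_le π _).trans ?_
    rw [CStarRing.norm_star_mul_self]
    have : ‖x‖ ≤ ρ := (pi_norm_le_iff_of_nonneg hρ).2 hx
    gcongr
  exact abs_le_of_sq_le_sq' (by nlinarith) hρ |>.2

lemma shiftU_comm (s : ι → A) (hs : ∀ i j, star (s i) * s j = if i = j then 1 else 0)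
    (σ : Equiv.Perm ι) (y : ι → A) (ρ ε₀ : ℝ) (hρ : 0 ≤ ρ) (hy : ∀ i, ‖y i - 1‖ ≤ ρ) (x : A)
    (h1 : ∀ i, ‖s i * x - x * s i‖ ≤ ε₀) (h2 : ∀ i, ‖s i * star x - star x * s i‖ ≤ ε₀) :
    ‖shiftU σ s y * x - x * shiftU σ s y‖ ≤ 4 * Fintype.card ι * ε₀ + 2 * ρ * ‖x‖ := by
  set D := ∑ k, s (σ k) * (y k - 1) * star (s k) with hD
  have hDn : ‖D‖ ≤ ρ := orth_sum_norm s hs σ _ ρ hρ hy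
  have hsn : ∀ i, ‖s i‖ ≤ 1 := fun i => isom_norm_le _ (by simp [hs])
  have hc : ∀ i j, ‖s i * star (s j) * x - x * (s i * star (s j))‖ ≤ 2 * ε₀ := by
    intro i j
    have e : s i * star (s j) * x - x * (s i * star (s j))
        = (s i * x - x * s i) * star (s j) - s i * star (s j * star x - star x * s j) := by
      simp only [star_sub, star_mul, star_star]; noncomm_ring
    rw [e]
    have a1 : ‖(s i * x - x * s i) * star (s j)‖ ≤ ε₀ := by
      refine (norm_mul_le _ _).trans ?_
      rw [norm_star]
      exact (mul_le_of_le_one_right (norm_nonneg _) (hsn j)).trans (h1 i)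
    have a2 : ‖s i * star (s j * star x - star x * s j)‖ ≤ ε₀ := by
      refine (norm_mul_le _ _).trans ?_
      rw [norm_star]
      exact (mul_le_of_le_one_left (norm_nonneg _) (hsn i)).trans (h2 j)
    refine (norm_sub_le _ _).trans ?_
    linarith
  have e : shiftU σ s y * x - x * shiftU σ s y =
      (∑ k, (s (σ k) * star (s k) * x - x * (s (σ k) * star (s k))))
      - (∑ k, (s k * star (s k) * x - x * (s k * star (s k)))) + (D * x - x * D) := by
    simp only [shiftU, hD, mul_sub, sub_mul, mul_one, Finset.sum_sub_distrib, ← Finset.sum_mul,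
      ← Finset.mul_sum]
    noncomm_ring
  rw [e]
  have b1 : ∀ τ : ι → ι, ‖∑ k, (s (τ k) * star (s k) * x - x * (s (τ k) * star (s k)))‖
      ≤ Fintype.card ι * (2 * ε₀) := by
    intro τ
    refine (norm_sum_le _ _).trans ((Finset.sum_le_sum fun k _ => hc (τ k) k).trans ?_)
    simp
  have b2 : ‖D * x - x * D‖ ≤ 2 * ρ * ‖x‖ := by
    refine (norm_sub_le _ _).trans ?_
    have a1 : ‖D * x‖ ≤ ρ * ‖x‖ := (norm_mul_le _ _).trans (by gcongr)
    have a2 : ‖x * D‖ ≤ ‖x‖ * ρ := (norm_mul_le _ _).trans (by gcongr)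
    linarith
  have := norm_add_le ((∑ k, (s (σ k) * star (s k) * x - x * (s (σ k) * star (s k))))
      - (∑ k, (s k * star (s k) * x - x * (s k * star (s k))))) (D * x - x * D)
  have := norm_sub_le (∑ k, (s (σ k) * star (s k) * x - x * (s (σ k) * star (s k))))
      (∑ k, (s k * star (s k) * x - x * (s k * star (s k))))
  have := b1 σ
  have := b1 id
  simp only [id] at this
  linarith

end key
end KbProof

namespace KbProof

section key2
variable {A : Type} [CStarAlgebra A]
open Filter Topology

lemma unitary_conj_norm (z x : A) (hz : z ∈ unitary A) : ‖z * x * star z‖ = ‖x‖ := by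
  have h1 : ∀ (z x : A), z ∈ unitary A → ‖z * x * star z‖ ≤ ‖x‖ := by
    intro z x hz
    have := isom_conj_norm_le (star z) x (by rw [star_star]; exact Unitary.mul_star_self_of_mem hz)
    rwa [star_star] at this
  refine le_antisymm (h1 z x hz) ?_
  have h2 := h1 (star z) (z * x * star z) (Unitary.star_mem hz)
  have e : star z * (z * x * star z) * star (star z) = x := by
    rw [star_star]
    simp only [mul_assoc]
    rw [Unitary.star_mul_self_of_mem hz, mul_one, ← mul_assoc, Unitary.star_mul_self_of_mem hz, one_mul]
  rwa [e] at h2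

lemma exists_conj [Nontrivial A] (hA : IsUnitalKirchberg A) (F : Finset A) (ε : ℝ)
    (w a e : A) (n : ℕ) (hw : w ∈ unitary A) (he : e ∈ unitary A)
    (hε : ∀ x ∈ F, 2 * ‖e - 1‖ * ‖x‖ < ε) (η : ℝ) (hη : 0 < η) :
    ∃ v ∈ unitary A, (∀ x ∈ F, ‖v * x - x * v‖ < ε) ∧
      ‖(w ^ n * e ^ n) * a * star (w ^ n * e ^ n) - a‖ <
        ‖(v * w) ^ n * a * star ((v * w) ^ n) - a‖ + η := by
  classical
  obtain ⟨ε₀, h0, c1, c2⟩ : ∃ ε₀ : ℝ, 0 < ε₀ ∧ (2 * n * ‖a‖ + 2) * ε₀ < η ∧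
      ∀ x ∈ F, 4 * (n + 1) * ε₀ + 2 * ‖e - 1‖ * ‖x‖ < ε := by
    have h : ∀ (k d : ℝ), 0 < d → ∀ᶠ η in 𝓝[>] (0 : ℝ), k * η < d := by
      intro k d hd
      have : Tendsto (fun η : ℝ => k * η) (𝓝[>] 0) (𝓝 (k * 0)) :=
        (continuous_const.mul continuous_id).continuousAt.tendsto.mono_left nhdsWithin_le_nhds
      rw [mul_zero] at this
      exact this.eventually_lt_const hd
    have h2 : ∀ᶠ ε₀ in 𝓝[>] (0 : ℝ), ∀ x ∈ F, 4 * (n + 1) * ε₀ + 2 * ‖e - 1‖ * ‖x‖ < ε := by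
      rw [Finset.eventually_all]
      intro x hx
      filter_upwards [h (4 * (n + 1)) (ε - 2 * ‖e - 1‖ * ‖x‖) (by linarith [hε x hx])] with r hr
      linarith
    obtain ⟨r, ⟨h1, h2⟩, h3⟩ := (((h (2 * n * ‖a‖ + 2) η hη).and h2).and self_mem_nhdsWithin).exists
    exact ⟨r, h3, h1, h2⟩
  obtain ⟨s, hs, hc⟩ := exists_central hA (insert w (insert a (F ∪ F.image star))) ε₀ h0 (n + 1)
  have hsn : ∀ i, ‖s i‖ ≤ 1 := fun i => isom_norm_le _ (by simp [hs])
  let y : Fin (n + 1) → A := fun k => w ^ ((k : ℕ) + 1) * e * star (w ^ ((k : ℕ) + 1))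
  have hwk : ∀ k, w ^ k ∈ unitary A := fun k => pow_mem hw k
  have hy : ∀ i, y i ∈ unitary A := fun i => mul_mem (mul_mem (hwk _) he) (Unitary.star_mem (hwk _))
  have hy1 : ∀ i, ‖y i - 1‖ ≤ ‖e - 1‖ := by
    intro i
    have : y i - 1 = w ^ ((i : ℕ) + 1) * (e - 1) * star (w ^ ((i : ℕ) + 1)) := by
      rw [mul_sub, sub_mul, mul_one, Unitary.mul_star_self_of_mem (hwk _)]
    rw [this, unitary_conj_norm _ _ (hwk _)]
  let σ : Equiv.Perm (Fin (n + 1)) := finRotate (n + 1)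
  let v : A := shiftU σ s y
  have hv : v ∈ unitary A := shiftU_unitary s hs σ y hy
  refine ⟨v, hv, fun x hx => ?_, ?_⟩
  · have := shiftU_comm s hs σ y ‖e - 1‖ ε₀ (norm_nonneg _) hy1 x
      (fun i => (hc x (by simp [hx]) i).le) (fun i => (hc (star x) (by simp [hx]) i).le)
    refine this.trans_lt ?_
    have := c2 x hx
    simpa using this
  -- powers
  have hUu : ∀ j, (v * w) ^ j ∈ unitary A := fun j => pow_mem (mul_mem hv hw) j
  have hpow : ∀ j : ℕ, ∀ hj : j < n + 1,
      ‖(v * w) ^ j * s 0 - s ⟨j, hj⟩ * (w ^ j * e ^ j)‖ ≤ j * ε₀ := by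
    intro j
    induction j with
    | zero => intro hj; simp
    | succ j ih =>
      intro hj
      have ih := ih (by omega)
      have hσ : σ ⟨j, by omega⟩ = ⟨j + 1, hj⟩ := finRotate_of_lt (by omega)
      have h1 : v * s ⟨j, by omega⟩ = s ⟨j + 1, hj⟩ * y ⟨j, by omega⟩ := by
        have := shiftU_apply s hs σ y ⟨j, by omega⟩
        rwa [hσ] at this
      have h2 : y ⟨j, by omega⟩ * w ^ (j + 1) = w ^ (j + 1) * e := by
        simp only [y]
        rw [mul_assoc, Unitary.star_mul_self_of_mem (hwk _), mul_one]
      have e1 : (v * w) ^ (j + 1) * s 0 - s ⟨j + 1, hj⟩ * (w ^ (j + 1) * e ^ (j + 1))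
          = (v * w) * ((v * w) ^ j * s 0 - s ⟨j, by omega⟩ * (w ^ j * e ^ j))
            - v * (s ⟨j, by omega⟩ * w - w * s ⟨j, by omega⟩) * (w ^ j * e ^ j) := by
        have h3 : v * (s ⟨j, by omega⟩ * w) * (w ^ j * e ^ j)
            = s ⟨j + 1, hj⟩ * (w ^ (j + 1) * e ^ (j + 1)) := by
          rw [← mul_assoc v, h1]
          calc _ = s ⟨j + 1, hj⟩ * (y ⟨j, by omega⟩ * (w * w ^ j)) * e ^ j := by
                simp only [mul_assoc]
            _ = _ := by rw [← pow_succ', h2, pow_succ' e]; simp only [mul_assoc]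
        rw [mul_sub v, sub_mul, h3, pow_succ' (v * w)]
        noncomm_ring
      rw [e1]
      have n1 : ∀ z ∈ unitary A, ∀ x : A, ‖z * x‖ ≤ ‖x‖ := by
        intro z hz x
        refine (norm_mul_le _ _).trans (mul_le_of_le_one_left (norm_nonneg _) ?_)
        exact isom_norm_le z (Unitary.star_mul_self_of_mem hz)
      have n2 : ∀ z ∈ unitary A, ∀ x : A, ‖x * z‖ ≤ ‖x‖ := by
        intro z hz x
        refine (norm_mul_le _ _).trans (mul_le_of_le_one_right (norm_nonneg _) ?_)
        exact isom_norm_le z (Unitary.star_mul_self_of_mem hz)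
      refine (norm_sub_le _ _).trans ?_
      have a1 := (n1 (v * w) (mul_mem hv hw)
        ((v * w) ^ j * s 0 - s ⟨j, by omega⟩ * (w ^ j * e ^ j))).trans ih
      have a2 := (n2 (w ^ j * e ^ j) (mul_mem (hwk j) (pow_mem he j))
        (v * (s ⟨j, by omega⟩ * w - w * s ⟨j, by omega⟩))).trans
        ((n1 v hv _).trans (hc w (by simp) ⟨j, by omega⟩).le)
      push_cast
      linarith
  -- conclusion
  set U := (v * w) ^ n with hU
  set z := w ^ n * e ^ n with hz
  have hzu : z ∈ unitary A := mul_mem (hwk n) (pow_mem he n)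
  set t := s ⟨n, by omega⟩ with ht
  have htt : star t * t = 1 := by simp [ht, hs]
  have hp := hpow n (by omega)
  rw [← ht, ← hU, ← hz] at hp
  have hq : ‖star U * t - s 0 * star z‖ ≤ n * ε₀ := by
    have e1 : star U * t - s 0 * star z = - (star U * (U * s 0 - t * z) * star z) := by
      have k1 := Unitary.star_mul_self_of_mem (hUu n)
      have k2 := Unitary.mul_star_self_of_mem hzu
      rw [← hU] at k1
      simp only [mul_sub, sub_mul]
      rw [← mul_assoc (star U) U, k1, one_mul, mul_assoc (star U), mul_assoc t, k2, mul_one]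
      abel
    rw [e1, norm_neg]
    refine (norm_mul_le _ _).trans ?_
    rw [norm_star]
    refine (mul_le_of_le_one_right (norm_nonneg _)
      (isom_norm_le z (Unitary.star_mul_self_of_mem hzu))).trans ?_
    refine (norm_mul_le _ _).trans ?_
    refine (mul_le_of_le_one_left (norm_nonneg _)
      (isom_norm_le (star U) ?_)).trans hp
    rw [star_star]
    exact Unitary.mul_star_self_of_mem (hUu n)
  have hac := hc a (by simp)
  have hst : ∀ i, ‖star (s i) * a * s i - a‖ ≤ ε₀ := by
    intro i
    have e1 : star (s i) * a * s i - a = - (star (s i) * (s i * a - a * s i)) := by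
      rw [mul_sub, ← mul_assoc, hs, if_pos rfl, one_mul]; noncomm_ring
    rw [e1, norm_neg]
    refine (norm_mul_le _ _).trans ?_
    rw [norm_star]
    exact (mul_le_of_le_one_left (norm_nonneg _) (hsn i)).trans (hac i).le
  have e2 : z * a * star z - a = star t * (U * a * star U - a) * t
      - star (star U * t - s 0 * star z) * (a * (star U * t))
      - z * star (s 0) * a * (star U * t - s 0 * star z)
      - z * (star (s 0) * a * s 0 - a) * star z
      + (star t * a * t - a) := by
    simp only [star_sub, star_mul, star_star]
    noncomm_ring
  have nU : ‖star U * t‖ ≤ 1 := by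
    refine isom_norm_le _ ?_
    rw [star_mul, star_star, mul_assoc, ← mul_assoc U,
      Unitary.mul_star_self_of_mem (hUu n), one_mul, htt]
  have nz : ‖z * star (s 0)‖ ≤ 1 := by
    refine (norm_mul_le _ _).trans ?_
    rw [norm_star]
    exact mul_le_one₀ (isom_norm_le z (Unitary.star_mul_self_of_mem hzu)) (norm_nonneg _) (hsn 0)
  have p1 : ‖star t * (U * a * star U - a) * t‖ ≤ ‖U * a * star U - a‖ := isom_conj_norm_le _ _ htt
  have p2 : ‖star (star U * t - s 0 * star z) * (a * (star U * t))‖ ≤ n * ε₀ * ‖a‖ := by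
    refine (norm_mul_le _ _).trans ?_
    rw [norm_star]
    refine mul_le_mul hq ?_ (norm_nonneg _) (by positivity)
    exact (norm_mul_le _ _).trans (mul_le_of_le_one_right (norm_nonneg _) nU)
  have p3 : ‖z * star (s 0) * a * (star U * t - s 0 * star z)‖ ≤ ‖a‖ * (n * ε₀) := by
    refine (norm_mul_le _ _).trans ?_
    refine mul_le_mul ?_ hq (norm_nonneg _) (norm_nonneg _)
    exact (norm_mul_le _ _).trans (mul_le_of_le_one_left (norm_nonneg _) nz)
  have p4 : ‖z * (star (s 0) * a * s 0 - a) * star z‖ ≤ ε₀ := by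
    rw [unitary_conj_norm _ _ hzu]; exact hst 0
  have p5 : ‖star t * a * t - a‖ ≤ ε₀ := hst _
  rw [e2]
  have q1 := norm_add_le (star t * (U * a * star U - a) * t
      - star (star U * t - s 0 * star z) * (a * (star U * t))
      - z * star (s 0) * a * (star U * t - s 0 * star z)
      - z * (star (s 0) * a * s 0 - a) * star z) (star t * a * t - a)
  have q2 := norm_sub_le (star t * (U * a * star U - a) * t
      - star (star U * t - s 0 * star z) * (a * (star U * t))
      - z * star (s 0) * a * (star U * t - s 0 * star z))
      (z * (star (s 0) * a * s 0 - a) * star z)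
  have q3 := norm_sub_le (star t * (U * a * star U - a) * t
      - star (star U * t - s 0 * star z) * (a * (star U * t)))
      (z * star (s 0) * a * (star U * t - s 0 * star z))
  have q4 := norm_sub_le (star t * (U * a * star U - a) * t)
      (star (star U * t - s 0 * star z) * (a * (star U * t)))
  linarith

/-- Unitaries with roots of arbitrarily high order close to one. -/
def HasRoots (u : A) : Prop :=
  ∀ ρ : ℝ, 0 < ρ → ∃ (n : ℕ) (e : A), e ∈ unitary A ∧ e ^ n = u ∧ ‖e - 1‖ < ρ

lemma key_lemma [Nontrivial A] (hA : IsUnitalKirchberg A) (F : Finset A) (ε : ℝ) (hε : 0 < ε)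
    (w a u : A) (hw : w ∈ unitary A) (hu : HasRoots u) (δ : ℝ)
    (hδ : 2 * δ < ‖u * a * star u - a‖) :
    ∃ v ∈ unitary A, (∀ x ∈ F, ‖v * x - x * v‖ < ε) ∧
      ∃ n : ℕ, δ < ‖(v * w) ^ n * a * star ((v * w) ^ n) - a‖ := by
  obtain ⟨M, hM0, hM⟩ : ∃ M : ℝ, 0 ≤ M ∧ ∀ x ∈ F, ‖x‖ ≤ M := by
    refine ⟨∑ x ∈ F, ‖x‖, Finset.sum_nonneg fun _ _ => norm_nonneg _, fun x hx => ?_⟩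
    exact Finset.single_le_sum (f := fun x => ‖x‖) (fun _ _ => norm_nonneg _) hx
  obtain ⟨n, e, he, hen, he1⟩ := hu (ε / (2 * (M + 1))) (by positivity)
  have hwn : w ^ n ∈ unitary A := pow_mem hw n
  have main : ∃ e' ∈ unitary A, (∀ x ∈ F, 2 * ‖e' - 1‖ * ‖x‖ < ε) ∧
      δ < ‖(w ^ n * e' ^ n) * a * star (w ^ n * e' ^ n) - a‖ := by
    by_cases h : δ < ‖w ^ n * a * star (w ^ n) - a‖
    · refine ⟨1, one_mem _, fun x _ => by simpa using hε, by simpa using h⟩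
    · refine ⟨e, he, fun x hx => ?_, ?_⟩
      · have h1 : ‖e - 1‖ * (2 * (M + 1)) < ε := (lt_div_iff₀ (by positivity)).1 he1
        have h2 := hM x hx
        have h3 := norm_nonneg (e - 1)
        nlinarith
      · push Not at h
        rw [hen]
        have e1 : w ^ n * (u * a * star u - a) * star (w ^ n) =
            (w ^ n * u * a * star (w ^ n * u) - a) - (w ^ n * a * star (w ^ n) - a) := by
          rw [star_mul]; noncomm_ring
        have e2 := unitary_conj_norm (w ^ n) (u * a * star u - a) hwn
        rw [e1] at e2
        have := norm_sub_le (w ^ n * u * a * star (w ^ n * u) - a) (w ^ n * a * star (w ^ n) - a)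
        linarith
  obtain ⟨e', h1, h2, h3⟩ := main
  obtain ⟨v, hv, hv1, hv2⟩ := exists_conj hA F ε w a e' n hw h1 h2 _ (sub_pos.2 h3)
  exact ⟨v, hv, hv1, n, by linarith⟩

lemma hasRoots_exp (h : selfAdjoint A) : HasRoots (selfAdjoint.expUnitary h : A) := by
  intro ρ hρ
  have h1 : Tendsto (fun n : ℕ => ((n : ℝ) + 1)⁻¹ • h) atTop (𝓝 ((0 : ℝ) • h)) := by
    refine Tendsto.smul_const ?_ h
    simpa only [one_div] using tendsto_one_div_add_atTop_nhds_zero_nat (𝕜 := ℝ)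
  rw [zero_smul] at h1
  have h2 := ((continuous_subtype_val.comp selfAdjoint.continuous_expUnitary).tendsto 0).comp h1
  have h3 := ((h2.sub_const 1).norm.eventually_lt_const (u := ρ) (by simpa using hρ))
  obtain ⟨n, hn⟩ := h3.exists
  refine ⟨n + 1, selfAdjoint.expUnitary (((n : ℝ) + 1)⁻¹ • h), Subtype.prop _, ?_, hn⟩
  have hp : ∀ (k : ℕ) (x : selfAdjoint A), (selfAdjoint.expUnitary x) ^ k
      = selfAdjoint.expUnitary ((k : ℝ) • x) := by
    intro k x
    induction k with
    | zero => simp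
    | succ k ih =>
      rw [pow_succ, ih, ← Commute.expUnitary_add]
      · congr 1; push_cast; rw [add_smul, one_smul]
      · change Commute ((k : ℝ) • (x : A)) (x : A)
        exact (Commute.refl _).smul_left _
  rw [← SubmonoidClass.coe_pow, hp, smul_smul]
  push_cast
  rw [mul_inv_cancel₀ (by positivity), one_smul]

end key2
end KbProof

namespace KbProof

section limit
variable {A : Type} [CStarAlgebra A]
open Filter Topology

/-- Inner conjugation map. -/
def conj (w x : A) : A := w * x * star w

lemma conj_sub (w x y : A) : conj w (x - y) = conj w x - conj w y := by
  simp [conj, mul_sub, sub_mul]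

lemma conj_norm (w x : A) (hw : w ∈ unitary A) : ‖conj w x‖ = ‖x‖ := unitary_conj_norm w x hw

lemma conj_iter (w x : A) (n : ℕ) : (conj w)^[n] x = w ^ n * x * star (w ^ n) := by
  induction n with
  | zero => simp
  | succ n ih =>
    rw [Function.iterate_succ', Function.comp, ih, conj, pow_succ' w, star_mul]
    simp only [mul_assoc]

lemma conj_conj (w x : A) (hw : w ∈ unitary A) : conj w (conj (star w) x) = x := by
  simp only [conj, star_star]
  calc _ = (w * star w) * x * (w * star w) := by simp only [mul_assoc]
    _ = _ := by rw [Unitary.mul_star_self_of_mem hw, one_mul, mul_one]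

lemma conj_mul_left (v w x : A) : conj (v * w) x = conj v (conj w x) := by
  simp only [conj, star_mul, mul_assoc]

lemma conj_near (v x : A) (hv : v ∈ unitary A) : ‖conj v x - x‖ ≤ ‖v * x - x * v‖ := by
  have e : conj v x - x = (v * x - x * v) * star v := by
    rw [sub_mul, mul_assoc x, Unitary.mul_star_self_of_mem hv, mul_one]; rfl
  rw [e]
  refine (norm_mul_le _ _).trans ?_
  rw [norm_star]
  exact mul_le_of_le_one_right (norm_nonneg _) (isom_norm_le v (Unitary.star_mul_self_of_mem hv))

lemma conj_near' (v x : A) (hv : v ∈ unitary A) : ‖conj (star v) x - x‖ ≤ ‖v * x - x * v‖ := by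
  have e : conj (star v) x - x = - (star v * (v * x - x * v)) := by
    rw [mul_sub, ← mul_assoc, Unitary.star_mul_self_of_mem hv, one_mul, conj, star_star]
    noncomm_ring
  rw [e, norm_neg]
  refine (norm_mul_le _ _).trans ?_
  rw [norm_star]
  exact mul_le_of_le_one_left (norm_nonneg _) (isom_norm_le v (Unitary.star_mul_self_of_mem hv))

/-- One step of the inductive construction. -/
lemma step_lemma [Nontrivial A] (hA : IsUnitalKirchberg A) (w : A) (hw : w ∈ unitary A)
    (E : Finset A) (ρ : ℝ) (hρ : 0 < ρ) (d a u : A) (hu : HasRoots u) :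
    ∃ (w' : A) (E' : Finset A) (ρ' : ℝ), w' ∈ unitary A ∧ 0 < ρ' ∧ E ⊆ E' ∧ d ∈ E' ∧ ρ' ≤ ρ / 2 ∧
      (∀ x ∈ E, ‖conj w' x - conj w x‖ ≤ ρ / 2) ∧
      (∀ x ∈ E, ‖conj (star w') x - conj (star w) x‖ ≤ ρ / 2) ∧
      ∀ β : A → A, (∀ x y, ‖β x - β y‖ ≤ ‖x - y‖) → (∀ x ∈ E', ‖β x - conj w' x‖ ≤ ρ') →
        ∃ n : ℕ, 1 / 4 * ‖u * a * star u - a‖ ≤ ‖β^[n] a - a‖ := by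
  classical
  by_cases h0 : ‖u * a * star u - a‖ = 0
  · refine ⟨w, insert d E, ρ / 2, hw, by positivity, Finset.subset_insert _ _, Finset.mem_insert_self _ _,
      le_rfl, fun x _ => ?_, fun x _ => ?_, fun β _ _ => ⟨0, by rw [h0]; simp⟩⟩
    · rw [sub_self, norm_zero]; positivity
    · rw [sub_self, norm_zero]; positivity
  have hpos : 0 < ‖u * a * star u - a‖ := lt_of_le_of_ne (norm_nonneg _) (Ne.symm h0)
  obtain ⟨v, hv, hvF, n, hn⟩ := key_lemma hA (E ∪ E.image (conj w)) (ρ / 2) (by positivity) w a u hw hu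
    (1 / 4 * ‖u * a * star u - a‖) (by linarith)
  set δ := 1 / 4 * ‖u * a * star u - a‖ with hδ
  have hw' : v * w ∈ unitary A := mul_mem hv hw
  set x : ℕ → A := fun i => (conj (v * w))^[i] a with hx
  have hxn : δ < ‖x n - a‖ := by simpa only [hx, conj_iter] using hn
  obtain ⟨ρ', p1, p2, p3⟩ : ∃ ρ' : ℝ, 0 < ρ' ∧ ρ' ≤ ρ / 2 ∧ n * ρ' ≤ ‖x n - a‖ - δ := by
    refine ⟨min (ρ / 2) ((‖x n - a‖ - δ) / (n + 1)), lt_min (by positivity)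
      (div_pos (by linarith) (by positivity)), min_le_left _ _, ?_⟩
    have h1 : min (ρ / 2) ((‖x n - a‖ - δ) / (n + 1)) * (n + 1) ≤ ‖x n - a‖ - δ :=
      (le_div_iff₀ (by positivity)).1 (min_le_right _ _)
    have h2 : 0 < min (ρ / 2) ((‖x n - a‖ - δ) / (n + 1)) := lt_min (by positivity)
      (div_pos (by linarith) (by positivity))
    linarith
  refine ⟨v * w, insert d (E ∪ (Finset.range n).image x), ρ', hw', p1, ?_, by simp, p2, ?_, ?_, ?_⟩
  · intro y hy; simp [hy]
  · intro y hy
    rw [conj_mul_left]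
    refine (conj_near v _ hv).trans (hvF _ ?_).le
    simp only [Finset.mem_union, Finset.mem_image]
    exact Or.inr ⟨y, hy, rfl⟩
  · intro y hy
    rw [star_mul, conj_mul_left, ← conj_sub, conj_norm _ _ (Unitary.star_mem hw)]
    refine (conj_near' v _ hv).trans (hvF _ ?_).le
    simp [hy]
  · intro β hβ hβE
    refine ⟨n, ?_⟩
    have key : ∀ i, i ≤ n → ‖β^[i] a - x i‖ ≤ i * ρ' := by
      intro i
      induction i with
      | zero => intro _; simp [hx]
      | succ i ih =>
        intro hi
        have ih := ih (by omega)
        have e1 : x (i + 1) = conj (v * w) (x i) := by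
          simp only [hx, Function.iterate_succ', Function.comp]
        rw [Function.iterate_succ', Function.comp, e1]
        have h1 := hβ (β^[i] a) (x i)
        have h2 := hβE (x i) (by
          simp only [Finset.mem_insert, Finset.mem_union, Finset.mem_image, Finset.mem_range]
          exact Or.inr (Or.inr ⟨i, by omega, rfl⟩))
        have h3 : β (β^[i] a) - conj (v * w) (x i)
            = (β (β^[i] a) - β (x i)) + (β (x i) - conj (v * w) (x i)) := by abel
        rw [h3]
        refine (norm_add_le _ _).trans ?_
        push_cast
        linarith
    have h1 := key n le_rfl
    have h2 : x n - a = (β^[n] a - a) - (β^[n] a - x n) := by abel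
    have h3 := norm_sub_le (β^[n] a - a) (β^[n] a - x n)
    rw [← h2] at h3
    linarith

/-- Pointwise limits of inner automorphisms. -/
lemma exists_limit (α : ℕ → A) (hα : ∀ k, α k ∈ unitary A) (d : ℕ → A) (hd : DenseRange d)
    (h : ∀ i, CauchySeq (fun k => conj (α k) (d i))) :
    ∃ γ : A → A, ∀ x, Tendsto (fun k => conj (α k) x) atTop (𝓝 (γ x)) := by
  have hc : ∀ x, CauchySeq (fun k => conj (α k) x) := by
    intro x
    rw [Metric.cauchySeq_iff']
    intro ε hε
    obtain ⟨i, hi⟩ := hd.exists_dist_lt x (show 0 < ε / 3 by positivity)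
    obtain ⟨N, hN⟩ := Metric.cauchySeq_iff'.1 (h i) (ε / 3) (by positivity)
    refine ⟨N, fun k hk => ?_⟩
    have h1 := hN k hk
    rw [dist_eq_norm] at h1 hi ⊢
    have e : conj (α k) x - conj (α N) x = conj (α k) (x - d i)
        + (conj (α k) (d i) - conj (α N) (d i)) - conj (α N) (x - d i) := by
      simp only [conj_sub]; abel
    rw [e]
    have a1 := norm_sub_le (conj (α k) (x - d i)
        + (conj (α k) (d i) - conj (α N) (d i))) (conj (α N) (x - d i))
    have a2 := norm_add_le (conj (α k) (x - d i)) (conj (α k) (d i) - conj (α N) (d i))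
    rw [conj_norm _ _ (hα _)] at a1 a2
    linarith
  choose γ hγ using fun x => cauchySeq_tendsto_of_complete (hc x)
  exact ⟨γ, hγ⟩

lemma exists_aut [Nontrivial A] (hA : IsUnitalKirchberg A) (a u : ℕ → A) (hu : ∀ k, HasRoots (u k)) :
    ∃ γ : A ≃⋆ₐ[ℂ] A, (∀ x, ‖γ x‖ = ‖x‖) ∧ ∀ k, ∃ n : ℕ,
      1 / 4 * ‖u k * a k * star (u k) - a k‖ ≤ ‖γ^[n] (a k) - a k‖ := by
  classical
  have := hA.separable
  let d : ℕ → A := TopologicalSpace.denseSeq A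
  have hd : DenseRange d := TopologicalSpace.denseRange_denseSeq A
  let St := {p : A × Finset A × ℝ // p.1 ∈ unitary A ∧ 0 < p.2.2}
  have hstep : ∀ (k : ℕ) (S : St), ∃ S' : St, S.1.2.1 ⊆ S'.1.2.1 ∧ d k ∈ S'.1.2.1 ∧
      S'.1.2.2 ≤ S.1.2.2 / 2 ∧
      (∀ x ∈ S.1.2.1, ‖conj S'.1.1 x - conj S.1.1 x‖ ≤ S.1.2.2 / 2) ∧
      (∀ x ∈ S.1.2.1, ‖conj (star S'.1.1) x - conj (star S.1.1) x‖ ≤ S.1.2.2 / 2) ∧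
      ∀ β : A → A, (∀ x y, ‖β x - β y‖ ≤ ‖x - y‖) →
        (∀ x ∈ S'.1.2.1, ‖β x - conj S'.1.1 x‖ ≤ S'.1.2.2) →
        ∃ n : ℕ, 1 / 4 * ‖u k * a k * star (u k) - a k‖ ≤ ‖β^[n] (a k) - a k‖ := by
    intro k S
    obtain ⟨w', E', ρ', h1, h2, h3⟩ := step_lemma hA S.1.1 S.2.1 S.1.2.1 S.1.2.2 S.2.2 (d k) (a k) (u k) (hu k)
    exact ⟨⟨(w', E', ρ'), h1, h2⟩, h3⟩
  choose nxt hnxt using hstep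
  let S : ℕ → St := fun n => Nat.rec ⟨(1, ∅, 1), one_mem _, one_pos⟩ (fun k s => nxt k s) n
  have hS : ∀ k, S (k + 1) = nxt k (S k) := fun k => rfl
  let w : ℕ → A := fun k => (S k).1.1
  let E : ℕ → Finset A := fun k => (S k).1.2.1
  let ρ : ℕ → ℝ := fun k => (S k).1.2.2
  have hw : ∀ k, w k ∈ unitary A := fun k => (S k).2.1
  have hρ : ∀ k, 0 < ρ k := fun k => (S k).2.2
  have hE : ∀ k, E k ⊆ E (k + 1) := fun k => (hnxt k (S k)).1
  have hdE : ∀ k, d k ∈ E (k + 1) := fun k => (hnxt k (S k)).2.1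
  have hρ2 : ∀ k, ρ (k + 1) ≤ ρ k / 2 := fun k => (hnxt k (S k)).2.2.1
  have hw1 : ∀ k, ∀ x ∈ E k, ‖conj (w (k + 1)) x - conj (w k) x‖ ≤ ρ k / 2 :=
    fun k => (hnxt k (S k)).2.2.2.1
  have hw2 : ∀ k, ∀ x ∈ E k, ‖conj (star (w (k + 1))) x - conj (star (w k)) x‖ ≤ ρ k / 2 :=
    fun k => (hnxt k (S k)).2.2.2.2.1
  have hreq : ∀ k, ∀ β : A → A, (∀ x y, ‖β x - β y‖ ≤ ‖x - y‖) →
        (∀ x ∈ E (k + 1), ‖β x - conj (w (k + 1)) x‖ ≤ ρ (k + 1)) →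
        ∃ n : ℕ, 1 / 4 * ‖u k * a k * star (u k) - a k‖ ≤ ‖β^[n] (a k) - a k‖ :=
    fun k => (hnxt k (S k)).2.2.2.2.2
  have hEm : Monotone E := monotone_nat_of_le_succ hE
  have htel : ∀ (t : ℕ → A), (∀ k, ∀ x ∈ E k, ‖conj (t (k + 1)) x - conj (t k) x‖ ≤ ρ k / 2) →
      ∀ j k, j ≤ k → ∀ x ∈ E j, ‖conj (t k) x - conj (t j) x‖ ≤ ρ j - ρ k := by
    intro t ht j k hjk x hx
    induction k, hjk using Nat.le_induction with
    | base => simp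
    | succ k hk ih =>
      have h1 := ht k x (hEm hk hx)
      have h2 := hρ2 k
      have h3 : conj (t (k + 1)) x - conj (t j) x
          = (conj (t (k + 1)) x - conj (t k) x) + (conj (t k) x - conj (t j) x) := by abel
      rw [h3]
      refine (norm_add_le _ _).trans ?_
      linarith
  have hρ0 : Tendsto ρ atTop (𝓝 0) := by
    have hb : ∀ k, ρ k ≤ (1 / 2) ^ k := by
      intro k
      induction k with
      | zero => exact le_of_eq (by simp [ρ, S])
      | succ k ih =>
        have := hρ2 k
        rw [pow_succ]; linarith
    exact squeeze_zero (fun k => (hρ k).le) hb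
      (tendsto_pow_atTop_nhds_zero_of_lt_one (by norm_num) (by norm_num))
  have hcau : ∀ (t : ℕ → A), (∀ k, ∀ x ∈ E k, ‖conj (t (k + 1)) x - conj (t k) x‖ ≤ ρ k / 2) →
      ∀ i, CauchySeq (fun k => conj (t k) (d i)) := by
    intro t ht i
    rw [Metric.cauchySeq_iff']
    intro ε hε
    obtain ⟨j, hj1, hj2⟩ := ((hρ0.eventually_lt_const hε).and (eventually_ge_atTop (i + 1))).exists
    refine ⟨j, fun k hk => ?_⟩
    rw [dist_eq_norm]
    have := htel t ht j k hk (d i) (hEm hj2 (hdE i))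
    have := hρ k
    linarith
  obtain ⟨γ, hγ⟩ := exists_limit w hw d hd (hcau w hw1)
  obtain ⟨γ', hγ'⟩ := exists_limit (fun k => star (w k)) (fun k => Unitary.star_mem (hw k)) d hd
    (hcau (fun k => star (w k)) hw2)
  have inv : ∀ (t : ℕ → A) (g g' : A → A), (∀ k, t k ∈ unitary A) →
      (∀ x, Tendsto (fun k => conj (t k) x) atTop (𝓝 (g x))) →
      (∀ x, Tendsto (fun k => conj (star (t k)) x) atTop (𝓝 (g' x))) → ∀ x, g (g' x) = x := by
    intro t g g' ht hg hg' x
    refine tendsto_nhds_unique (hg (g' x)) ?_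
    rw [tendsto_iff_norm_sub_tendsto_zero]
    have h1 := tendsto_iff_norm_sub_tendsto_zero.1 (hg' x)
    refine h1.congr fun k => ?_
    conv_rhs => rw [← conj_conj (t k) x (ht k), ← conj_sub, conj_norm _ _ (ht k)]
    rw [norm_sub_rev, conj_conj _ _ (ht k)]
  let Γ : A ≃⋆ₐ[ℂ] A :=
    { toFun := γ
      invFun := γ'
      left_inv := inv (fun k => star (w k)) γ' γ (fun k => Unitary.star_mem (hw k)) hγ'
        (by simpa only [star_star] using hγ)
      right_inv := inv w γ γ' hw hγ hγ'
      map_mul' := by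
        intro x y
        refine tendsto_nhds_unique (hγ (x * y)) (((hγ x).mul (hγ y)).congr fun k => ?_)
        simp only [conj]
        calc _ = w k * x * (star (w k) * w k) * y * star (w k) := by simp only [mul_assoc]
          _ = _ := by rw [Unitary.star_mul_self_of_mem (hw k)]; simp only [mul_assoc, one_mul]
      map_add' := by
        intro x y
        refine tendsto_nhds_unique (hγ (x + y)) (((hγ x).add (hγ y)).congr fun k => ?_)
        simp only [conj, mul_add, add_mul]
      map_star' := by
        intro x
        refine tendsto_nhds_unique (hγ (star x)) (((hγ x).star).congr fun k => ?_)
        simp only [conj, star_mul, star_star, mul_assoc]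
      map_smul' := by
        intro c x
        refine tendsto_nhds_unique (hγ (c • x)) (((hγ x).const_smul c).congr fun k => ?_)
        simp only [conj, mul_smul_comm, smul_mul_assoc] }
  have hΓn : ∀ x, ‖γ x‖ = ‖x‖ := fun x =>
    tendsto_nhds_unique (hγ x).norm (by simp only [conj_norm _ _ (hw _)]; exact tendsto_const_nhds)
  refine ⟨Γ, hΓn, fun k => hreq k γ ?_ ?_⟩
  · intro x y
    have : γ x - γ y = γ (x - y) := (map_sub Γ x y).symm
    rw [this, hΓn]
  · intro x hx
    refine le_of_tendsto ((hγ x).sub_const _).norm ?_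
    filter_upwards [eventually_ge_atTop (k + 1)] with l hl
    have := htel w hw1 (k + 1) l hl x hx
    have := hρ l
    linarith

end limit
end KbProof

namespace KbProof

section final
variable {A : Type} [CStarAlgebra A]
open Filter Topology

lemma central_scalar [Nontrivial A] (hpi : ∀ a : A, a ≠ 0 → ∃ x y : A, x * a * y = 1)
    (b : A) (hb : ∀ x, Commute b x) : ∃ z : ℂ, b = z • (1 : A) := by
  obtain ⟨z, hz⟩ := spectrum.nonempty b
  refine ⟨z, ?_⟩
  by_contra hne
  have h1 : algebraMap ℂ A z - b ≠ 0 := by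
    rw [Algebra.algebraMap_eq_smul_one]
    intro h; exact hne (sub_eq_zero.1 h).symm
  obtain ⟨x, y, hxy⟩ := hpi _ h1
  have hc : ∀ t, Commute (algebraMap ℂ A z - b) t := fun t =>
    Commute.sub_left (Algebra.commute_algebraMap_left z t) (hb t)
  refine hz ?_
  refine ⟨⟨algebraMap ℂ A z - b, x * y, ?_, ?_⟩, rfl⟩
  · rw [← mul_assoc, (hc x).eq, hxy]
  · rw [mul_assoc, ← (hc y).eq, ← mul_assoc, hxy]

lemma commute_of_exp (b : A) (h : selfAdjoint A)
    (hb : ∀ t : ℝ, Commute b (selfAdjoint.expUnitary (t • h) : A)) : Commute b (h : A) := by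
  have h1 := hasDerivAt_exp_smul_const (𝕂 := ℝ) (Complex.I • (h : A)) (0 : ℝ)
  rw [zero_smul, NormedSpace.exp_zero, one_mul] at h1
  have h2 := (h1.const_mul b).sub (h1.mul_const b)
  have h3 : ((fun t : ℝ => b * NormedSpace.exp (t • (Complex.I • (h : A)))) -
      fun t : ℝ => NormedSpace.exp (t • (Complex.I • (h : A))) * b) = fun _ => 0 := by
    funext t
    have := (hb t).eq
    rw [selfAdjoint.expUnitary_coe] at this
    have e : Complex.I • ((t • h : selfAdjoint A) : A) = t • (Complex.I • (h : A)) := by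
      rw [smul_comm]; rfl
    rw [e] at this
    simp only [Pi.sub_apply]
    rw [this, sub_self]
  rw [h3] at h2
  have h4 := h2.unique (hasDerivAt_const (0 : ℝ) (0 : A))
  have h5 : Complex.I • (b * (h : A)) = Complex.I • ((h : A) * b) := by
    rw [mul_smul_comm, smul_mul_assoc] at h4
    exact sub_eq_zero.1 h4
  exact smul_right_injective A Complex.I_ne_zero h5

lemma exists_ergodic [Nontrivial A] (hA : IsUnitalKirchberg A) :
    ∃ γ : A ≃⋆ₐ[ℂ] A, (∀ x, ‖γ x‖ = ‖x‖) ∧ ∀ b, γ b = b → ∃ z : ℂ, b = z • (1 : A) := by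
  have := hA.separable
  have : SecondCountableTopology A := UniformSpace.secondCountable_of_separable A
  let d : ℕ → A := TopologicalSpace.denseSeq A
  have hd : DenseRange d := TopologicalSpace.denseRange_denseSeq A
  let h : ℕ → selfAdjoint A := TopologicalSpace.denseSeq (selfAdjoint A)
  have hh : DenseRange h := TopologicalSpace.denseRange_denseSeq _
  let u : ℕ → A := fun j => (selfAdjoint.expUnitary (h j) : A)
  obtain ⟨γ, hn, hγ⟩ := exists_aut hA (fun k => d (Nat.unpair k).1) (fun k => u (Nat.unpair k).2)
    (fun k => hasRoots_exp _)
  refine ⟨γ, hn, fun b hb => central_scalar hA.purely_infinite b ?_⟩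
  have hit : ∀ n a, ‖γ^[n] a - b‖ = ‖a - b‖ := by
    intro n a
    induction n with
    | zero => rfl
    | succ n ih =>
      rw [Function.iterate_succ', Function.comp]
      conv_lhs => rw [← hb, ← map_sub, hn, ih]
  have hu : ∀ j, conj (u j) b = b := by
    intro j
    have huj : u j ∈ unitary A := Subtype.prop _
    rw [← sub_eq_zero, ← norm_le_zero_iff]
    refine le_of_forall_pos_le_add fun ε hε => ?_
    obtain ⟨i, hi⟩ := hd.exists_dist_lt b (show 0 < ε / 10 by positivity)
    rw [dist_eq_norm] at hi
    obtain ⟨n, hn'⟩ := hγ (Nat.pair i j)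
    simp only [Nat.unpair_pair] at hn'
    have h1 : ‖γ^[n] (d i) - d i‖ ≤ 2 * ‖b - d i‖ := by
      have e : γ^[n] (d i) - d i = (γ^[n] (d i) - b) + (b - d i) := by abel
      rw [e]
      refine (norm_add_le _ _).trans ?_
      rw [hit, norm_sub_rev]; linarith
    have e : conj (u j) b - b = conj (u j) (b - d i) + (u j * d i * star (u j) - d i) - (b - d i) := by
      rw [conj_sub]; simp only [conj]; abel
    have a1 := norm_sub_le (conj (u j) (b - d i) + (u j * d i * star (u j) - d i)) (b - d i)
    have a2 := norm_add_le (conj (u j) (b - d i)) (u j * d i * star (u j) - d i)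
    rw [conj_norm _ _ huj] at a2
    rw [e]
    linarith
  have hall : ∀ x : selfAdjoint A, Commute b (selfAdjoint.expUnitary x : A) := by
    intro x
    have hcont : Continuous (fun x : selfAdjoint A => (selfAdjoint.expUnitary x : A)) :=
      continuous_subtype_val.comp selfAdjoint.continuous_expUnitary
    have hcl : IsClosed {x : selfAdjoint A | b * (selfAdjoint.expUnitary x : A)
        = (selfAdjoint.expUnitary x : A) * b} :=
      isClosed_eq (continuous_const.mul hcont) (hcont.mul continuous_const)
    refine hh.induction_on (p := fun x => b * (selfAdjoint.expUnitary x : A)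
        = (selfAdjoint.expUnitary x : A) * b) x hcl fun j => ?_
    have huj : u j ∈ unitary A := Subtype.prop _
    have := hu j
    calc b * u j = conj (u j) b * u j := by rw [this]
      _ = u j * b := by
        rw [conj, mul_assoc, Unitary.star_mul_self_of_mem huj, mul_one]
  have hsa : ∀ x : selfAdjoint A, Commute b (x : A) := fun x => commute_of_exp b x fun t => hall _
  intro x
  rw [← realPart_add_I_smul_imaginaryPart x]
  exact (hsa _).add_right ((hsa _).smul_right _)

lemma no_finite_order [Nontrivial A] (hA : IsUnitalKirchberg A) (γ : A ≃⋆ₐ[ℂ] A)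
    (hn : ∀ x, ‖γ x‖ = ‖x‖) (hfix : ∀ b, γ b = b → ∃ z : ℂ, b = z • (1 : A))
    (N : ℕ) (hN : 0 < N) (h : ∀ x, (γ ^ N) x = x) : False := by
  let : PartialOrder A := CStarAlgebra.spectralOrder A
  let : StarOrderedRing A := CStarAlgebra.spectralOrderedRing A
  obtain ⟨s, t, hs, ht, hst⟩ := hA.properly_infinite
  obtain ⟨T, hT⟩ := exists_orth s t hs ht hst
  let p : ℕ → A := fun i => T i * star (T i)
  have hpp : ∀ i, star (p i) * p i = p i := by
    intro i
    simp only [p, star_mul, star_star]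
    rw [mul_assoc, ← mul_assoc (star (T i)), hT, if_pos rfl, one_mul]
  have hp1 : ∀ i, 1 ≤ ‖p i‖ := by
    intro i
    have e : star (T i) * p i * T i = 1 := by
      simp only [p]
      rw [← mul_assoc, hT, if_pos rfl, one_mul, hT, if_pos rfl]
    have := isom_conj_norm_le (T i) (p i) (by rw [hT, if_pos rfl])
    rw [e, norm_one] at this
    exact this
  have hnk : ∀ (k : ℕ) x, ‖(γ ^ k) x‖ = ‖x‖ := by
    intro k x
    induction k with
    | zero => rfl
    | succ k ih => rw [pow_succ', StarAlgEquiv.aut_mul, StarAlgEquiv.trans_apply, hn, ih]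
  have hsucc : ∀ (k : ℕ) x, γ ((γ ^ k) x) = (γ ^ (k + 1)) x := by
    intro k x; rw [pow_succ', StarAlgEquiv.aut_mul, StarAlgEquiv.trans_apply]
  have hfixS : ∀ x, γ (∑ k ∈ Finset.range N, (γ ^ k) x) = ∑ k ∈ Finset.range N, (γ ^ k) x := by
    intro x
    rw [map_sum]
    simp only [hsucc]
    have h1 := Finset.sum_range_succ (fun k => (γ ^ k) x) N
    have h2 := Finset.sum_range_succ' (fun k => (γ ^ k) x) N
    rw [h1, h x] at h2
    have h3 : (γ ^ 0) x = x := rfl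
    rw [h3] at h2
    exact (add_right_cancel h2).symm
  have hpos : ∀ i k, 0 ≤ (γ ^ k) (p i) := by
    intro i k
    rw [← hpp i, map_mul, map_star]
    exact star_mul_self_nonneg _
  have hr : ∀ i, ∃ r : ℝ, 1 ≤ r ∧ ∑ k ∈ Finset.range N, (γ ^ k) (p i) = (r : ℂ) • (1 : A) := by
    intro i
    obtain ⟨z, hz⟩ := hfix _ (hfixS (p i))
    have h0 : 0 ≤ ∑ k ∈ Finset.range N, (γ ^ k) (p i) := Finset.sum_nonneg fun k _ => hpos i k
    have hle : p i ≤ ∑ k ∈ Finset.range N, (γ ^ k) (p i) :=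
      Finset.single_le_sum (f := fun k => (γ ^ k) (p i)) (fun k _ => hpos i k) (Finset.mem_range.2 hN)
    have hnorm := (hp1 i).trans (CStarAlgebra.norm_le_norm_of_nonneg_of_le (by
      rw [← hpp i]; exact star_mul_self_nonneg _) hle)
    rw [hz] at h0 hnorm
    have hzs := (IsSelfAdjoint.of_nonneg h0).star_eq
    rw [star_smul, star_one] at hzs
    have hz2 : star z = z := smul_left_injective ℂ (one_ne_zero (α := A)) hzs
    have hz3 : ((z.re : ℝ) : ℂ) = z := Complex.conj_eq_iff_re.1 hz2
    have hz4 : 0 ≤ z.re := by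
      have hm : z.re ∈ spectrum ℝ (z • (1 : A)) := by
        have e : z • (1 : A) = algebraMap ℝ A z.re := by
          rw [← hz3, Algebra.algebraMap_eq_smul_one]; rfl
        rw [e, spectrum.scalar_eq]; rfl
      exact spectrum_nonneg_of_nonneg h0 hm
    refine ⟨z.re, ?_, by rw [hz3, hz]⟩
    rw [norm_smul, norm_one, mul_one, ← hz3, Complex.norm_real, Real.norm_eq_abs, abs_of_nonneg hz4]
      at hnorm
    exact hnorm
  choose r hr1 hr2 using hr
  let P : A := ∑ i ∈ Finset.range (N + 1), p i
  have hP : ‖P‖ ≤ 1 := by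
    have hs : ∀ i j : Fin (N + 1), star (T i) * T j = if i = j then 1 else 0 := by
      intro i j; rw [hT]; simp [Fin.val_inj]
    have := orth_sum_norm (fun i : Fin (N + 1) => T i) hs 1 (fun _ => 1) 1 zero_le_one
      (fun _ => by rw [norm_one])
    simp only [mul_one, Equiv.Perm.coe_one, id] at this
    simp only [P, Finset.sum_range, p]
    exact this
  have e1 : ∑ k ∈ Finset.range N, (γ ^ k) P = ((∑ i ∈ Finset.range (N + 1), r i : ℝ) : ℂ) • (1 : A) := by
    simp only [P, map_sum]
    rw [Finset.sum_comm]
    simp only [hr2, Complex.ofReal_sum, Finset.sum_smul]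
  have e2 : ‖∑ k ∈ Finset.range N, (γ ^ k) P‖ ≤ N := by
    refine (norm_sum_le _ _).trans ((Finset.sum_le_sum fun k _ => ((hnk k P).le.trans hP)).trans ?_)
    simp
  have e3 : (N : ℝ) + 1 ≤ ∑ i ∈ Finset.range (N + 1), r i := by
    have := Finset.sum_le_sum (s := Finset.range (N + 1)) fun i _ => hr1 i
    simpa using this
  rw [e1, norm_smul, norm_one, mul_one, Complex.norm_real, Real.norm_eq_abs] at e2
  have := le_abs_self (∑ i ∈ Finset.range (N + 1), r i)
  linarith

lemma not_inner_pow [Nontrivial A] (hA : IsUnitalKirchberg A) (γ : A ≃⋆ₐ[ℂ] A)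
    (hn : ∀ x, ‖γ x‖ = ‖x‖) (hfix : ∀ b, γ b = b → ∃ z : ℂ, b = z • (1 : A))
    (n : ℕ) (h0 : 0 < n) (u : A) (hu : u ∈ unitary A) (h : ∀ x, (γ ^ n) x = u * x * star u) :
    False := by
  have h1 : γ 1 = 1 := by
    have := map_mul γ (γ.symm 1) 1
    rw [mul_one, StarAlgEquiv.apply_symm_apply, one_mul] at this
    exact this.symm
  have hγu : γ u ∈ unitary A := by
    rw [Unitary.mem_iff] at hu ⊢
    rw [← map_star, ← map_mul, ← map_mul, hu.1, hu.2, h1]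
    exact ⟨rfl, rfl⟩
  have hsucc : ∀ (k : ℕ) x, γ ((γ ^ k) x) = (γ ^ (k + 1)) x := by
    intro k x; rw [pow_succ', StarAlgEquiv.aut_mul, StarAlgEquiv.trans_apply]
  have hsucc' : ∀ (k : ℕ) x, (γ ^ k) (γ x) = (γ ^ (k + 1)) x := by
    intro k x; rw [pow_succ, StarAlgEquiv.aut_mul, StarAlgEquiv.trans_apply]
  have hu1 := Unitary.star_mul_self_of_mem hu
  have hu2 := Unitary.mul_star_self_of_mem hu
  have hg1 := Unitary.star_mul_self_of_mem hγu
  obtain ⟨z, hz⟩ : ∃ z : ℂ, star u * γ u = z • (1 : A) := by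
    refine central_scalar hA.purely_infinite _ fun x => ?_
    have e := (hsucc n (γ.symm x)).trans (hsucc' n (γ.symm x)).symm
    rw [h, h, map_mul, map_mul, map_star, StarAlgEquiv.apply_symm_apply] at e
    change star u * γ u * x = x * (star u * γ u)
    calc star u * γ u * x = star u * (γ u * x * star (γ u)) * γ u := by
          simp only [mul_assoc]; rw [hg1, mul_one]
      _ = _ := by
          rw [e]; simp only [← mul_assoc]; rw [hu1, one_mul]
  have hgu : γ u = z • u := by
    have : u * (star u * γ u) = u * (z • 1) := by rw [hz]
    rwa [← mul_assoc, hu2, one_mul, mul_smul_comm, mul_one] at this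
  have hgk : ∀ k : ℕ, (γ ^ k) u = z ^ k • u := by
    intro k
    induction k with
    | zero => simp
    | succ k ih => rw [← hsucc, ih, map_smul, hgu, smul_smul, pow_succ]
  have hu0 : u ≠ 0 := by
    rintro rfl
    rw [mul_zero] at hu1
    exact zero_ne_one hu1
  have hzn : z ^ n = 1 := by
    have e := h u
    rw [hgk, mul_assoc, hu2, mul_one] at e
    have : z ^ n • u = (1 : ℂ) • u := by rw [e, one_smul]
    exact smul_left_injective ℂ hu0 this
  have hpow : ∀ k : ℕ, γ (u ^ k) = z ^ k • u ^ k := by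
    intro k
    induction k with
    | zero => simp [h1]
    | succ k ih =>
      rw [pow_succ u, map_mul, ih, hgu, smul_mul_smul_comm, ← pow_succ]
  obtain ⟨c, hc⟩ := hfix (u ^ n) (by rw [hpow, hzn, one_smul])
  refine no_finite_order hA γ hn hfix (n * n) (by positivity) fun x => ?_
  have hit : ∀ k : ℕ, (γ ^ (n * k)) x = u ^ k * x * star (u ^ k) := by
    intro k
    induction k with
    | zero => simp
    | succ k ih =>
      rw [Nat.mul_succ, add_comm, pow_add, StarAlgEquiv.aut_mul, StarAlgEquiv.trans_apply, ih, h,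
        pow_succ' u, star_mul]
      simp only [mul_assoc]
  rw [hit n]
  have hcomm : u ^ n * x = x * u ^ n := by rw [hc, smul_mul_assoc, mul_smul_comm, one_mul, mul_one]
  rw [hcomm, mul_assoc, Unitary.mul_star_self_of_mem (pow_mem hu n), mul_one]

theorem main_result (A : Type) [CStarAlgebra A] (hA : IsUnitalKirchberg A) :
    ∃ γ : CStarAction (Multiplicative ℤ) A,
      (∀ n : ℤ, n ≠ 0 → ¬ IsInnerAut (γ.app (Multiplicative.ofAdd n))) ∧
      {a : A | γ.app (Multiplicative.ofAdd 1) a = a}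
        = Set.range (fun z : ℂ => z • (1 : A)) := by
  have : Nontrivial A := by
    obtain ⟨a, ha⟩ := hA.simple.1
    exact ⟨a, 0, ha⟩
  obtain ⟨γ, hn, hfix⟩ := exists_ergodic hA
  refine ⟨⟨fun g => γ ^ (Multiplicative.toAdd g), fun a => rfl, fun g k a => ?_⟩, ?_, ?_⟩
  · rw [toAdd_mul, zpow_add, StarAlgEquiv.aut_mul, StarAlgEquiv.trans_apply]
  · rintro n hn0 ⟨u, hu, hu'⟩
    change ∀ a, (γ ^ n) a = u * a * star u at hu'
    rcases lt_or_gt_of_ne hn0 with hlt | hgt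
    · obtain ⟨m, rfl⟩ := Int.exists_eq_neg_ofNat hlt.le
      refine not_inner_pow hA γ hn hfix m (by omega) (star u) (Unitary.star_mem hu) fun x => ?_
      have e := hu' (star u * x * star (star u))
      have e2 : u * (star u * x * star (star u)) * star u = x := by
        have := conj_conj u x hu
        exact this
      rw [e2, zpow_neg, zpow_natCast] at e
      calc (γ ^ m) x = (γ ^ m) ((γ ^ m)⁻¹ (star u * x * star (star u))) := by rw [e]
        _ = (γ ^ m * (γ ^ m)⁻¹) (star u * x * star (star u)) := rfl
        _ = _ := by rw [mul_inv_cancel]; rfl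
    · obtain ⟨m, rfl⟩ := Int.eq_ofNat_of_zero_le hgt.le
      refine not_inner_pow hA γ hn hfix m (by omega) u hu fun x => ?_
      have := hu' x
      rwa [zpow_natCast] at this
  · ext b
    change (γ ^ (1 : ℤ)) b = b ↔ _
    rw [zpow_one, Set.mem_range]
    constructor
    · intro hb
      obtain ⟨z, hz⟩ := hfix b hb
      exact ⟨z, hz.symm⟩
    · rintro ⟨z, rfl⟩
      have h1 : γ 1 = 1 := by
        have := map_mul γ (γ.symm 1) 1
        rw [mul_one, StarAlgEquiv.apply_symm_apply, one_mul] at this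
        exact this.symm
      rw [map_smul, h1]

end final
end KbProof

/-- Every unital Kirchberg algebra admits an aperiodic automorphism
(no nonzero power is inner) whose fixed point algebra is `ℂ1`. -/
theorem exists_aperiodic_automorphism_with_trivial_fixed_points
    (A : Type) [CStarAlgebra A] (hA : IsUnitalKirchberg A) :
    ∃ γ : CStarAction (Multiplicative ℤ) A,
      (∀ n : ℤ, n ≠ 0 → ¬ IsInnerAut (γ.app (Multiplicative.ofAdd n))) ∧
      {a : A | γ.app (Multiplicative.ofAdd 1) a = a}
        = Set.range (fun z : ℂ => z • (1 : A)) := by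
  exact KbProof.main_result A hA
end

section
/- Let E ⊂ B(H) be a unital essential extension of a unital separable nuclear C*-algebra C by K, represented non-degenerately on H, let X := H ⊗ l²(ℤ) ⊗ E be the associated Hilbert E–E-bimodule, and let T_X be the Toeplitz–Pimsner algebra of X. Let Γ ∈ Aut(T_X) be the quasi-free automorphism determined by Γ(T_{ζ⊗δ_n⊗x}) := T_{ζ⊗δ_{n+1}⊗x} for ζ ∈ H, n ∈ ℤ, x ∈ E. Then the fixed point algebras satisfy (T_X)^Γ = (T_X)^{Γ^N} = E for every N ∈ ℤ∖{0}. -/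
namespace ToeplitzShiftSetting

/-- Normally ordered words. -/
inductive NW (S : ToeplitzShiftSetting) : S.TX → Prop
  | base (a : S.E) : NW S (S.ιE a)
  | left (ζ : S.H) (n : ℤ) (x : S.E) (w : S.TX) : NW S w → NW S (S.Tcr ζ n x * w)
  | right (ζ : S.H) (n : ℤ) (x : S.E) (w : S.TX) : NW S w → NW S (w * star (S.Tcr ζ n x))

/-- Span of the normally ordered words. -/
noncomputable def sp (S : ToeplitzShiftSetting) : Submodule ℂ S.TX := Submodule.span ℂ {w | NW S w}

/-- To show that left multiplication by `z` preserves the span, check it on words. -/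
lemma sp_left (S : ToeplitzShiftSetting) (z : S.TX) (h : ∀ w, NW S w → z * w ∈ S.sp) :
    ∀ w ∈ S.sp, z * w ∈ S.sp := by
  intro w hw
  induction hw using Submodule.span_induction with
  | mem w hw => exact h w hw
  | zero => simp
  | add a b _ _ ha hb => rw [mul_add]; exact add_mem ha hb
  | smul c a _ ha => rw [mul_smul_comm]; exact Submodule.smul_mem _ _ ha

lemma sp_right_star (S : ToeplitzShiftSetting) (ζ : S.H) (n : ℤ) (x : S.E) :
    ∀ w ∈ S.sp, w * star (S.Tcr ζ n x) ∈ S.sp := by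
  intro w hw
  induction hw using Submodule.span_induction with
  | mem w hw => exact Submodule.subset_span (NW.right ζ n x w hw)
  | zero => simp
  | add a b _ _ ha hb => rw [add_mul]; exact add_mem ha hb
  | smul c a _ ha => rw [smul_mul_assoc]; exact Submodule.smul_mem _ _ ha

lemma sp_T (S : ToeplitzShiftSetting) (ζ : S.H) (n : ℤ) (x : S.E) :
    ∀ w ∈ S.sp, S.Tcr ζ n x * w ∈ S.sp :=
  S.sp_left _ fun w hw => Submodule.subset_span (NW.left ζ n x w hw)

lemma sp_E (S : ToeplitzShiftSetting) (a : S.E) :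
    ∀ w ∈ S.sp, S.ιE a * w ∈ S.sp := by
  refine S.sp_left _ fun w hw => ?_
  induction hw with
  | base b => rw [← map_mul]; exact Submodule.subset_span (NW.base _)
  | left ζ n x w hw _ =>
    rw [← mul_assoc, S.Tcr_left]; exact Submodule.subset_span (NW.left _ _ _ _ hw)
  | right ζ n x w hw ih => rw [← mul_assoc]; exact S.sp_right_star _ _ _ _ ih

lemma sp_Tstar (S : ToeplitzShiftSetting) (ζ : S.H) (n : ℤ) (x : S.E) :
    ∀ w ∈ S.sp, star (S.Tcr ζ n x) * w ∈ S.sp := by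
  refine S.sp_left _ fun w hw => ?_
  induction hw with
  | base b =>
    have : star (S.Tcr ζ n x) * S.ιE b = S.ιE 1 * star (S.Tcr (S.rep (star b) ζ) n x) := by
      rw [← S.Tcr_left, star_mul, map_star, star_star, map_one, one_mul]
    rw [this]; exact Submodule.subset_span (NW.right _ _ _ _ (NW.base _))
  | left ξ m y w hw _ =>
    rw [← mul_assoc, S.Tcr_star]
    split_ifs
    · rw [smul_mul_assoc]
      exact Submodule.smul_mem _ _ (S.sp_E _ _ (Submodule.subset_span hw))
    · simp
  | right ξ m y w hw ih => rw [← mul_assoc]; exact S.sp_right_star _ _ _ _ ih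

lemma adjoin_le_sp (S : ToeplitzShiftSetting) (z : S.TX)
    (hz : z ∈ NonUnitalStarAlgebra.adjoin ℂ {t : S.TX | ∃ ζ n x, t = S.Tcr ζ n x}) :
    z ∈ S.sp := by
  have key : (∀ w ∈ S.sp, z * w ∈ S.sp) ∧ (∀ w ∈ S.sp, star z * w ∈ S.sp) := by
    induction hz using NonUnitalStarAlgebra.adjoin_induction with
    | mem t ht =>
      obtain ⟨ζ, n, x, rfl⟩ := ht
      exact ⟨S.sp_T ζ n x, S.sp_Tstar ζ n x⟩
    | add a b _ _ ha hb =>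
      refine ⟨fun w hw => ?_, fun w hw => ?_⟩
      · rw [add_mul]; exact add_mem (ha.1 w hw) (hb.1 w hw)
      · rw [star_add, add_mul]; exact add_mem (ha.2 w hw) (hb.2 w hw)
    | zero => simp
    | mul a b _ _ ha hb =>
      refine ⟨fun w hw => ?_, fun w hw => ?_⟩
      · rw [mul_assoc]; exact ha.1 _ (hb.1 w hw)
      · rw [star_mul, mul_assoc]; exact hb.2 _ (ha.2 w hw)
    | smul c a _ ha =>
      refine ⟨fun w hw => ?_, fun w hw => ?_⟩
      · rw [smul_mul_assoc]; exact Submodule.smul_mem _ _ (ha.1 w hw)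
      · rw [star_smul, smul_mul_assoc]; exact Submodule.smul_mem _ _ (ha.2 w hw)
    | star a _ ha => exact ⟨ha.2, by rw [star_star]; exact ha.1⟩
  have h1 : (1 : S.TX) ∈ S.sp := by
    rw [← map_one S.ιE]; exact Submodule.subset_span (NW.base 1)
  simpa using key.1 1 h1

lemma norm_app (S : ToeplitzShiftSetting) (g : Multiplicative ℤ) (t : S.TX) :
    ‖S.Γ.app g t‖ = ‖t‖ := by
  exact NonUnitalStarAlgHom.norm_map (S.Γ.app g) (S.Γ.app g).injective t

/-- Ergodic averages of `Γ^N`. -/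
noncomputable def avg (S : ToeplitzShiftSetting) (N : ℤ) (M : ℕ) (t : S.TX) : S.TX :=
  ((M : ℂ)⁻¹) • ∑ j ∈ Finset.range M, S.Γ.app (Multiplicative.ofAdd (N * (j : ℤ))) t

lemma avg_add (S : ToeplitzShiftSetting) (N : ℤ) (M : ℕ) (s t : S.TX) :
    S.avg N M (s + t) = S.avg N M s + S.avg N M t := by
  simp [avg, Finset.sum_add_distrib]

lemma avg_smul (S : ToeplitzShiftSetting) (N : ℤ) (M : ℕ) (c : ℂ) (t : S.TX) :
    S.avg N M (c • t) = c • S.avg N M t := by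
  simp only [avg, map_smul]
  rw [← Finset.smul_sum, smul_comm]

lemma avg_star (S : ToeplitzShiftSetting) (N : ℤ) (M : ℕ) (t : S.TX) :
    S.avg N M (star t) = star (S.avg N M t) := by
  simp [avg, star_sum, star_smul, map_star]

lemma avg_fix (S : ToeplitzShiftSetting) (N : ℤ) (M : ℕ) (hM : M ≠ 0) (t : S.TX)
    (h : ∀ j : ℕ, S.Γ.app (Multiplicative.ofAdd (N * (j : ℤ))) t = t) :
    S.avg N M t = t := by
  have hM' : (M : ℂ) ≠ 0 := by exact_mod_cast hM
  rw [avg, Finset.sum_congr rfl (fun j _ => h j), Finset.sum_const, Finset.card_range,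
    ← Nat.cast_smul_eq_nsmul ℂ, smul_smul, inv_mul_cancel₀ hM', one_smul]

lemma norm_avg_le (S : ToeplitzShiftSetting) (N : ℤ) (M : ℕ) (hM : M ≠ 0) (t : S.TX) :
    ‖S.avg N M t‖ ≤ ‖t‖ := by
  have hM' : (0 : ℝ) < M := by positivity
  rw [avg, norm_smul, norm_inv, Complex.norm_natCast]
  have : ‖∑ j ∈ Finset.range M, S.Γ.app (Multiplicative.ofAdd (N * (j : ℤ))) t‖ ≤ M * ‖t‖ := by
    refine (norm_sum_le _ _).trans ?_
    simp [norm_app]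
  rw [inv_mul_le_iff₀ hM']
  exact this

lemma avg_T_tendsto (S : ToeplitzShiftSetting) (N : ℤ) (hN : N ≠ 0) (ζ : S.H) (n : ℤ)
    (x : S.E) (r : S.TX) :
    Filter.Tendsto (fun M : ℕ => S.avg N M (S.Tcr ζ n x * r)) Filter.atTop (nhds 0) := by
  set c : S.TX := (inner ℂ ζ ζ : ℂ) • S.ιE (star x * x) with hc
  set K : ℝ := ‖r‖ * ‖c‖ * ‖r‖ with hK
  have hb : ∀ M : ℕ, ‖S.avg N M (S.Tcr ζ n x * r)‖ ≤ Real.sqrt (K / M) := by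
    intro M
    rcases Nat.eq_zero_or_pos M with rfl | hM
    · simp [avg]
    have hM' : (0 : ℝ) < M := by exact_mod_cast hM
    apply Real.le_sqrt_of_sq_le
    set u : S.TX := ∑ j ∈ Finset.range M,
      S.Γ.app (Multiplicative.ofAdd (N * (j : ℤ))) (S.Tcr ζ n x * r) with hu
    have huu : star u * u = ∑ j ∈ Finset.range M,
        star (S.Γ.app (Multiplicative.ofAdd (N * (j : ℤ))) r) * c *
          S.Γ.app (Multiplicative.ofAdd (N * (j : ℤ))) r := by
      rw [hu, star_sum, Finset.sum_mul]
      refine Finset.sum_congr rfl fun i hi => ?_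
      rw [Finset.mul_sum, Finset.sum_eq_single i]
      · rw [map_mul, S.Γ_cr, star_mul, mul_assoc, ← mul_assoc (star (S.Tcr _ _ _)), S.Tcr_star,
          if_pos rfl, ← mul_assoc]
      · intro j _ hji
        rw [map_mul (S.Γ.app (Multiplicative.ofAdd (N * (i : ℤ)))),
          map_mul (S.Γ.app (Multiplicative.ofAdd (N * (j : ℤ)))), S.Γ_cr, S.Γ_cr, star_mul, mul_assoc,
          ← mul_assoc (star (S.Tcr _ _ _)), S.Tcr_star, if_neg, zero_mul, mul_zero]
        intro h
        have h2 : N * (i : ℤ) = N * (j : ℤ) := by linarith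
        have h3 := mul_left_cancel₀ hN h2
        exact hji (by exact_mod_cast h3.symm)
      · intro h; exact absurd hi h
    have h1 : ‖u‖ * ‖u‖ ≤ M * K := by
      rw [← CStarRing.norm_star_mul_self, huu]
      refine (norm_sum_le _ _).trans ?_
      have : ∀ j ∈ Finset.range M, ‖star (S.Γ.app (Multiplicative.ofAdd (N * (j : ℤ))) r) * c *
          S.Γ.app (Multiplicative.ofAdd (N * (j : ℤ))) r‖ ≤ K := by
        intro j _
        refine (norm_mul_le _ _).trans ?_
        rw [norm_app]
        refine mul_le_mul_of_nonneg_right ((norm_mul_le _ _).trans ?_) (norm_nonneg _)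
        rw [norm_star, norm_app]
      refine (Finset.sum_le_sum this).trans ?_
      simp
    rw [avg, norm_smul, norm_inv, Complex.norm_natCast, mul_pow, ← hu]
    calc ((M : ℝ)⁻¹) ^ 2 * ‖u‖ ^ 2 ≤ ((M : ℝ)⁻¹) ^ 2 * (M * K) := by
          rw [sq ‖u‖]; gcongr
      _ = K / M := by field_simp
  refine squeeze_zero_norm hb ?_
  have h0 : Filter.Tendsto (fun M : ℕ => K / (M : ℝ)) Filter.atTop (nhds 0) :=
    tendsto_const_div_atTop_nhds_zero_nat K
  have h1 := (Real.continuous_sqrt.tendsto 0).comp h0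
  rw [Real.sqrt_zero] at h1
  exact h1

lemma avg_sp_tendsto (S : ToeplitzShiftSetting) (N : ℤ) (hN : N ≠ 0) (t : S.TX)
    (ht : t ∈ S.sp) :
    ∃ a : S.E, Filter.Tendsto (fun M : ℕ => S.avg N M t) Filter.atTop (nhds (S.ιE a)) := by
  induction ht using Submodule.span_induction with
  | mem w hw =>
    cases hw with
    | base a =>
      refine ⟨a, tendsto_const_nhds.congr' ?_⟩
      filter_upwards [Filter.eventually_ne_atTop 0] with M hM
      exact (S.avg_fix N M hM _ fun j => S.Γ_ι _ _).symm
    | left ζ n x w hw => exact ⟨0, by rw [map_zero]; exact S.avg_T_tendsto N hN ζ n x w⟩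
    | right ζ n x w hw =>
      refine ⟨0, ?_⟩
      have h := (S.avg_T_tendsto N hN ζ n x (star w)).star
      simpa [← avg_star] using h
  | zero => exact ⟨0, by simp [avg]⟩
  | add s t _ _ hs ht =>
    obtain ⟨a, ha⟩ := hs
    obtain ⟨b, hb⟩ := ht
    refine ⟨a + b, ?_⟩
    simp only [avg_add, map_add]
    exact ha.add hb
  | smul c s _ hs =>
    obtain ⟨a, ha⟩ := hs
    refine ⟨c • a, ?_⟩
    simp only [avg_smul, map_smul]
    exact ha.const_smul c

lemma fixed_iter (S : ToeplitzShiftSetting) (N : ℤ) (y : S.TX)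
    (h : S.Γ.app (Multiplicative.ofAdd N) y = y) (j : ℕ) :
    S.Γ.app (Multiplicative.ofAdd (N * (j : ℤ))) y = y := by
  induction j with
  | zero => simpa using S.Γ.app_one y
  | succ k ih =>
    have : N * ((k + 1 : ℕ) : ℤ) = N * k + N := by push_cast; ring
    rw [this, ofAdd_add, S.Γ.app_mul, h, ih]

lemma fixed_mem (S : ToeplitzShiftSetting) (N : ℤ) (hN : N ≠ 0) (y : S.TX)
    (h : S.Γ.app (Multiplicative.ofAdd N) y = y) : y ∈ Set.range ⇑S.ιE := by
  have hcl : IsClosed (Set.range ⇑S.ιE) :=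
    (NonUnitalStarAlgHom.isometry S.ιE S.ιE_inj).isClosedEmbedding.isClosed_range
  rw [← hcl.closure_eq, Metric.mem_closure_iff]
  intro ε hε
  have hy : y ∈ closure ((NonUnitalStarAlgebra.adjoin ℂ
      {t : S.TX | ∃ ζ n x, t = S.Tcr ζ n x} : NonUnitalStarSubalgebra ℂ S.TX) : Set S.TX) := by
    rw [S.generates]; trivial
  obtain ⟨z, hz, hyz⟩ := Metric.mem_closure_iff.1 hy ε hε
  obtain ⟨a, ha⟩ := S.avg_sp_tendsto N hN z (S.adjoin_le_sp z hz)
  refine ⟨S.ιE a, ⟨a, rfl⟩, lt_of_le_of_lt ?_ hyz⟩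
  refine le_of_tendsto (tendsto_const_nhds.dist ha) ?_
  filter_upwards [Filter.eventually_ne_atTop 0] with M hM
  have e : S.avg N M (y - z) = y - S.avg N M z := by
    have h1 := S.avg_add N M (y - z) z
    rw [sub_add_cancel, S.avg_fix N M hM y (S.fixed_iter N y h)] at h1
    exact eq_sub_of_add_eq h1.symm
  rw [dist_eq_norm, dist_eq_norm, ← e]
  exact S.norm_avg_le N M hM _

end ToeplitzShiftSetting

/-- In the Toeplitz--Pimsner setting of a unital essential extension
`K ◁ E` of `C` represented on `H`, with `X = H ⊗ ℓ²(ℤ) ⊗ E` and the shift quasi-free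
automorphism `Γ` of `T_X`, one has `(T_X)^Γ = (T_X)^{Γ^N} = E` for every `N ≠ 0`. -/
theorem toeplitz_shift_fixed_points (S : ToeplitzShiftSetting) :
    ({y : S.TX | ∀ n : ℤ, S.Γ.app (Multiplicative.ofAdd n) y = y} = Set.range ⇑S.ιE) ∧
    ∀ N : ℤ, N ≠ 0 →
      {y : S.TX | S.Γ.app (Multiplicative.ofAdd N) y = y} = Set.range ⇑S.ιE := by
  have main : ∀ N : ℤ, N ≠ 0 →
      {y : S.TX | S.Γ.app (Multiplicative.ofAdd N) y = y} = Set.range ⇑S.ιE := by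
    intro N hN
    ext y
    constructor
    · exact fun h => S.fixed_mem N hN y h
    · rintro ⟨a, rfl⟩
      exact S.Γ_ι N a
  refine ⟨?_, main⟩
  ext y
  constructor
  · exact fun h => S.fixed_mem 1 one_ne_zero y (h 1)
  · rintro ⟨a, rfl⟩
    exact fun n => S.Γ_ι n a
end
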